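/- Assume the DVV hypothesis stated in the context. Then for every integer n ≥ 3 and every w > 0: Σ_{g≥0,k≥1, 2g−1+k=n, 2g−2+k>0} (1/(k−1)!)·w^{5/2}·(∂_1Ω_{g,k})(w,…,w) = Σ_{2g−1+k=n−1} (1/(k−1)!)·[(x^{5/2}∂_x)²Ω_{g,k}(x,w,…,w)]|_{x=w} + Σ_{2g−1+k=n−1, k≥2} (1/(k−2)!)·[x^{5/2}∂_x·y^{5/2}∂_y·Ω_{g,k}(x,y,w,…,w)]|_{x=y=w} + Σ_{i+j=n, i,j≥2} ( Σ_{2g_1−1+k_1=i} (1/(k_1−1)!)·w^{5/2}·(∂_1Ω_{g_1,k_1})(w,…,w) )·( Σ_{2g_2−1+k_2=j} (1/(k_2−1)!)·w^{5/2}·(∂_1Ω_{g_2,k_2})(w,…,w) ), where ∂_1 denotes the partial derivative in the first argument, (x^{5/2}∂_x)² is the square of the operator f ↦ x^{5/2}∂_x f acting in the first slot, and all sums over (g,k), (g_1,k_1), (g_2,k_2) run over stable pairs (2g−2+k > 0). -/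

import Mathlib

open Finset

/-- Real value of the double factorial `k‼` of an integer (with `k‼ = 1` for `k ≤ 0`,
in particular `(-1)‼ = 1`). -/
noncomputable def dfac (k : ℤ) : ℝ := (Nat.doubleFactorial k.toNat : ℝ)

/-- The rescaled correlator `⟨τ̃_{a_1} ⋯ τ̃_{a_n}⟩_g` with `τ̃_a = (2a+1)!! τ_a`. -/
noncomputable def ttau (τ : ℤ → (n : ℕ) → (Fin n → ℤ) → ℝ) (g : ℤ) (n : ℕ)
    (a : Fin n → ℤ) : ℝ :=
  (∏ i, dfac (2 * a i + 1)) * τ g n a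

/-- The DVV hypothesis: a symmetric family of correlators `⟨τ_{a_1} ⋯ τ_{a_n}⟩_g`,
vanishing unless `2g-2+n > 0`, all indices are nonnegative and `∑ aᵢ = 3g-3+n`
(in particular vanishing for `g < 0`), satisfying the Dijkgraaf–Verlinde–Verlinde
(Virasoro) recursion relations. -/
structure DVVFamily (τ : ℤ → (n : ℕ) → (Fin n → ℤ) → ℝ) : Prop where
  symm : ∀ (g : ℤ) (n : ℕ) (a : Fin n → ℤ) (σ : Equiv.Perm (Fin n)), τ g n (a ∘ σ) = τ g n a
  vanish : ∀ (g : ℤ) (n : ℕ) (a : Fin n → ℤ),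
      ¬((∀ i, 0 ≤ a i) ∧ 0 < 2 * g - 2 + (n : ℤ) ∧ (∑ i, a i) = 3 * g - 3 + n) → τ g n a = 0
  dvv : ∀ (g : ℤ) (n : ℕ), 0 ≤ g → 3 ≤ 2 * g + (n : ℤ) → ∀ (a₀ : ℤ) (a : Fin n → ℤ),
      0 ≤ a₀ → (∀ i, 0 ≤ a i) →
      ttau τ g (n + 1) (Fin.cons a₀ a) =
        (∑ i, (2 * (a i : ℝ) + 1) * ttau τ g n (Function.update a i (a₀ + a i - 1)))
        + (1 / 2) * ∑ b₁ ∈ Finset.Icc (0 : ℤ) (a₀ - 2),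
            (ttau τ (g - 1) (n + 2) (Fin.cons b₁ (Fin.cons (a₀ - 2 - b₁) a))
             + ∑ g₁ ∈ Finset.Icc (0 : ℤ) g, ∑ A ∈ (univ : Finset (Fin n)).powerset,
                if 0 < 2 * g₁ - 1 + (A.card : ℤ) ∧ 0 < 2 * (g - g₁) - 1 + ((Aᶜ).card : ℤ) then
                  ttau τ g₁ (A.card + 1) (Fin.cons b₁ (fun j => a (A.orderIsoOfFin rfl j).1))
                  * ttau τ (g - g₁) ((Aᶜ).card + 1)
                      (Fin.cons (a₀ - 2 - b₁) (fun j => a ((Aᶜ).orderIsoOfFin rfl j).1))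
                else 0)

/-- The antiderivative generating function
`Ω_{g,n}(w_1,…,w_n) = ∑ ⟨τ_{a_1}⋯τ_{a_n}⟩_g ∏ (2aᵢ-1)!! wᵢ^{aᵢ+1/2}` (with `(-1)!! = 1`),
written as a finite sum over `0 ≤ aᵢ ≤ 3g-3+n`. -/
noncomputable def OmegaF (τ : ℤ → (n : ℕ) → (Fin n → ℤ) → ℝ) (g : ℤ) (n : ℕ)
    (w : Fin n → ℝ) : ℝ :=
  ∑ a : Fin n → Fin ((3 * g + n - 3).toNat + 1),
    τ g n (fun i => ((a i : ℕ) : ℤ))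
      * ∏ i, dfac (2 * ((a i : ℕ) : ℤ) - 1) * w i ^ (((a i : ℕ) : ℝ) + 1 / 2)

/-- `w^{5/2} (∂₁Ω_{g,m+1})(w,…,w)`. -/
noncomputable def Aterm (τ : ℤ → (n : ℕ) → (Fin n → ℤ) → ℝ) (w : ℝ) (g m : ℕ) : ℝ :=
  w ^ ((5 : ℝ) / 2) *
    deriv (fun t => OmegaF τ g (m + 1) (Fin.cons t (fun _ : Fin m => w))) w

/-- `[(x^{5/2}∂ₓ)² Ω_{g,m+1}(x,w,…,w)]|_{x=w}`. -/
noncomputable def Bterm (τ : ℤ → (n : ℕ) → (Fin n → ℤ) → ℝ) (w : ℝ) (g m : ℕ) : ℝ :=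
  w ^ ((5 : ℝ) / 2) *
    deriv (fun x => x ^ ((5 : ℝ) / 2) *
      deriv (fun t => OmegaF τ g (m + 1) (Fin.cons t (fun _ : Fin m => w))) x) w

/-- `[x^{5/2}∂ₓ · y^{5/2}∂_y · Ω_{g,m+2}(x,y,w,…,w)]|_{x=y=w}`. -/
noncomputable def Cterm (τ : ℤ → (n : ℕ) → (Fin n → ℤ) → ℝ) (w : ℝ) (g m : ℕ) : ℝ :=
  w ^ ((5 : ℝ) / 2) * w ^ ((5 : ℝ) / 2) *
    deriv (fun x => deriv
      (fun y => OmegaF τ g (m + 2) (Fin.cons x (Fin.cons y (fun _ : Fin m => w)))) w) w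

/-- The sum `Σ_{g≥0,k≥1, 2g-1+k=n, (g,k) stable} (1/(k-1)!) w^{5/2} (∂₁Ω_{g,k})(w,…,w)`;
for `n ≥ 2` the stable pairs are exactly `(g, n+1-2g)` with `2g ≤ n`. -/
noncomputable def diagSum (τ : ℤ → (n : ℕ) → (Fin n → ℤ) → ℝ) (w : ℝ) (n : ℕ) : ℝ :=
  ∑ g ∈ Finset.range (n + 1),
    if 2 * g ≤ n then (1 / (Nat.factorial (n - 2 * g) : ℝ)) * Aterm τ w g (n - 2 * g) else 0

section Correlators

variable {τ : ℤ → (n : ℕ) → (Fin n → ℤ) → ℝ}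

lemma DVVFamily.ttau_eq_zero (h : DVVFamily τ) {g : ℤ} {n : ℕ} {a : Fin n → ℤ}
    (ha : ¬((∀ i, 0 ≤ a i) ∧ 0 < 2 * g - 2 + (n : ℤ) ∧ (∑ i, a i) = 3 * g - 3 + n)) :
    ttau τ g n a = 0 := by
  rw [ttau, h.vanish g n a ha, mul_zero]

lemma DVVFamily.ttau_comp_perm (h : DVVFamily τ) (g : ℤ) {n : ℕ} (a : Fin n → ℤ)
    (σ : Equiv.Perm (Fin n)) : ttau τ g n (a ∘ σ) = ttau τ g n a := by
  rw [ttau, ttau, h.symm]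
  congr 1
  exact Equiv.prod_comp σ fun i => dfac (2 * a i + 1)

lemma DVVFamily.ttau_insertNth (h : DVVFamily τ) (g : ℤ) {n : ℕ} (p : Fin (n + 1)) (x : ℤ)
    (a : Fin n → ℤ) :
    ttau τ g (n + 1) (p.insertNth x a : Fin (n + 1) → ℤ) = ttau τ g (n + 1) (Fin.cons x a) := by
  rw [← Fin.insertNth_comp_cycleRange_symm p x a, h.ttau_comp_perm]

/-- The integer tuple underlying a tuple of bounded natural numbers. -/
def toInt {m N : ℕ} (a : Fin m → Fin N) : Fin m → ℤ := fun i => ((a i : ℕ) : ℤ)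

/-- The weight `∏ᵢ (2aᵢ+1)⁻¹`. -/
noncomputable def oddWeight {m N : ℕ} (a : Fin m → Fin N) : ℝ :=
  ∏ i, (2 * ((a i : ℕ) : ℝ) + 1)⁻¹

/-- The sum `∑_a ⟨τ̃_c τ̃_{a_1}⋯τ̃_{a_m}⟩_g ∏ᵢ (2aᵢ+1)⁻¹` over `0 ≤ aᵢ < N`. -/
noncomputable def onePoint (τ : ℤ → (n : ℕ) → (Fin n → ℤ) → ℝ) (N : ℕ) (g : ℤ) (m : ℕ)
    (c : ℤ) : ℝ :=
  ∑ a : Fin m → Fin N, oddWeight a * ttau τ g (m + 1) (Fin.cons c (toInt a))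

/-- The sum `∑_a ⟨τ̃_b τ̃_c τ̃_{a_1}⋯τ̃_{a_m}⟩_g ∏ᵢ (2aᵢ+1)⁻¹` over `0 ≤ aᵢ < N`. -/
noncomputable def twoPoint (τ : ℤ → (n : ℕ) → (Fin n → ℤ) → ℝ) (N : ℕ) (g : ℤ) (m : ℕ)
    (b c : ℤ) : ℝ :=
  ∑ a : Fin m → Fin N, oddWeight a * ttau τ g (m + 2) (Fin.cons b (Fin.cons c (toInt a)))

lemma toInt_nonneg {m N : ℕ} (a : Fin m → Fin N) (i : Fin m) : 0 ≤ toInt a i :=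
  Int.natCast_nonneg _

lemma sum_toInt_nonneg {m N : ℕ} (a : Fin m → Fin N) : 0 ≤ ∑ i, toInt a i :=
  Finset.sum_nonneg fun i _ => toInt_nonneg a i

lemma DVVFamily.onePoint_eq_zero (h : DVVFamily τ) {N m : ℕ} {g c : ℤ}
    (hc : ¬(0 ≤ c ∧ c ≤ 3 * g - 2 + m)) : onePoint τ N g m c = 0 := by
  refine Finset.sum_eq_zero fun a _ => ?_
  rw [h.ttau_eq_zero, mul_zero]
  rintro ⟨h0, -, hs⟩
  have h1 := h0 0
  have h2 := sum_toInt_nonneg a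
  rw [Fin.sum_cons] at hs
  rw [Fin.cons_zero] at h1
  push_cast at hs
  omega

lemma DVVFamily.twoPoint_eq_zero (h : DVVFamily τ) {N m : ℕ} {g b c : ℤ}
    (hc : ¬(b + c ≤ 3 * g - 1 + m)) : twoPoint τ N g m b c = 0 := by
  refine Finset.sum_eq_zero fun a _ => ?_
  rw [h.ttau_eq_zero, mul_zero]
  rintro ⟨-, -, hs⟩
  have h2 := sum_toInt_nonneg a
  rw [Fin.sum_cons, Fin.sum_cons] at hs
  push_cast at hs
  omega

lemma toInt_insertNth {m N : ℕ} (p : Fin (m + 1)) (x : Fin N) (a : Fin m → Fin N) :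
    toInt (p.insertNth x a : Fin (m + 1) → Fin N) = p.insertNth ((x : ℕ) : ℤ) (toInt a) := by
  refine (Fin.eq_insertNth_iff).2 ⟨?_, ?_⟩
  · simp [toInt]
  · ext j; simp [toInt, Fin.removeNth]

lemma oddWeight_insertNth {m N : ℕ} (p : Fin (m + 1)) (x : Fin N) (a : Fin m → Fin N) :
    oddWeight (p.insertNth x a : Fin (m + 1) → Fin N)
      = (2 * ((x : ℕ) : ℝ) + 1)⁻¹ * oddWeight a := by
  simp [oddWeight, Fin.prod_univ_succAbove _ p]

lemma DVVFamily.sum_oddWeight_mul_ttau_update (h : DVVFamily τ) (N : ℕ) (g : ℤ) (m : ℕ) (c : ℤ) :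
    ∑ a : Fin (m + 1) → Fin N, oddWeight a * ∑ i, (2 * (toInt a i : ℝ) + 1) *
        ttau τ g (m + 1) (Function.update (toInt a) i (c + toInt a i - 1))
      = (m + 1) * ∑ x : Fin N, onePoint τ N g m (c + ((x : ℕ) : ℤ) - 1) := by
  simp_rw [Finset.mul_sum]
  rw [Finset.sum_comm]
  have key : ∀ i : Fin (m + 1), ∑ a : Fin (m + 1) → Fin N, oddWeight a *
      ((2 * (toInt a i : ℝ) + 1) *
        ttau τ g (m + 1) (Function.update (toInt a) i (c + toInt a i - 1)))
      = ∑ x : Fin N, onePoint τ N g m (c + ((x : ℕ) : ℤ) - 1) := by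
    intro i
    rw [← Equiv.sum_comp (Fin.insertNthEquiv (fun _ => Fin N) i), Fintype.sum_prod_type]
    refine Finset.sum_congr rfl fun x _ => Finset.sum_congr rfl fun a _ => ?_
    change oddWeight (i.insertNth x a : Fin (m + 1) → Fin N) *
      ((2 * (toInt (i.insertNth x a : Fin (m + 1) → Fin N) i : ℝ) + 1) *
        ttau τ g (m + 1) (Function.update (toInt (i.insertNth x a : Fin (m + 1) → Fin N)) i
          (c + toInt (i.insertNth x a : Fin (m + 1) → Fin N) i - 1))) = _
    rw [oddWeight_insertNth, toInt_insertNth, Fin.insertNth_apply_same, Fin.update_insertNth,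
      h.ttau_insertNth, Int.cast_natCast]
    have : (2 * ((x : ℕ) : ℝ) + 1) ≠ 0 := by positivity
    field_simp
  rw [Finset.sum_congr rfl fun i _ => key i]
  simp [Finset.mul_sum]

lemma sum_mul_restrict_compl {m : ℕ} {X : Type*} [Fintype X] (A : Finset (Fin m))
    (F : (Fin A.card → X) → ℝ) (G : (Fin (Aᶜ).card → X) → ℝ) :
    ∑ a : Fin m → X, F (fun j => a (A.orderIsoOfFin rfl j).1)
        * G (fun j => a ((Aᶜ).orderIsoOfFin rfl j).1) = (∑ a, F a) * ∑ a, G a := by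
  rw [Fintype.sum_mul_sum, ← Fintype.sum_prod_type']
  refine Fintype.sum_equiv (((finSumEquivOfFinset (s := A) rfl rfl).symm.arrowCongr
    (Equiv.refl X)).trans (Equiv.sumArrowEquivProdArrow _ _ _)) _ _ fun a => ?_
  simp [Equiv.arrowCongr, Equiv.sumArrowEquivProdArrow, Function.comp_def]

lemma oddWeight_eq_mul_compl {m N : ℕ} (A : Finset (Fin m)) (a : Fin m → Fin N) :
    oddWeight a = oddWeight (fun j => a (A.orderIsoOfFin rfl j).1)
      * oddWeight (fun j => a ((Aᶜ).orderIsoOfFin rfl j).1) := by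
  rw [oddWeight, ← Equiv.prod_comp (finSumEquivOfFinset (s := A) rfl rfl), Fintype.prod_sum_type]
  simp [oddWeight]

lemma sum_oddWeight_mul_ttau_mul_ttau (N : ℕ) (g₁ g₂ : ℤ) {m : ℕ} (b₁ b₂ : ℤ)
    (A : Finset (Fin m)) :
    ∑ a : Fin m → Fin N, oddWeight a *
        (ttau τ g₁ (A.card + 1) (Fin.cons b₁ (fun j => toInt a (A.orderIsoOfFin rfl j).1))
          * ttau τ g₂ ((Aᶜ).card + 1)
              (Fin.cons b₂ (fun j => toInt a ((Aᶜ).orderIsoOfFin rfl j).1)))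
      = onePoint τ N g₁ A.card b₁ * onePoint τ N g₂ (m - A.card) b₂ := by
  have hcard : m - A.card = (Aᶜ).card := by rw [Finset.card_compl, Fintype.card_fin]
  rw [hcard, onePoint, onePoint, ← sum_mul_restrict_compl]
  refine Finset.sum_congr rfl fun a _ => ?_
  rw [oddWeight_eq_mul_compl A a]
  unfold toInt
  ring

/-- The pairs of stable components `(g₁, j+1)`, `(g₂, k+1)` split off from `(g, m+1)`. -/
noncomputable def splitSum (τ : ℤ → (n : ℕ) → (Fin n → ℤ) → ℝ) (N : ℕ) (g : ℤ) (m : ℕ)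
    (b₁ b₂ : ℤ) : ℝ :=
  ∑ g₁ ∈ Finset.Icc (0 : ℤ) g, ∑ j ∈ Finset.range (m + 1),
    (m.choose j : ℝ) *
      if 0 < 2 * g₁ - 1 + (j : ℤ) ∧ 0 < 2 * (g - g₁) - 1 + ((m - j : ℕ) : ℤ) then
        onePoint τ N g₁ j b₁ * onePoint τ N (g - g₁) (m - j) b₂
      else 0

/-- The DVV recursion summed against `∏ᵢ (2aᵢ+1)⁻¹`. -/
lemma DVVFamily.onePoint_recursion (h : DVVFamily τ) (N : ℕ) {g : ℤ} (hg : 0 ≤ g) (m : ℕ)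
    (hgm : 3 ≤ 2 * g + (m : ℤ)) {c : ℤ} (hc : 0 ≤ c) :
    onePoint τ N g m c =
      m * ∑ x : Fin N, onePoint τ N g (m - 1) (c + ((x : ℕ) : ℤ) - 1)
      + (1 / 2) * ∑ b ∈ Finset.Icc (0 : ℤ) (c - 2),
          (twoPoint τ N (g - 1) m b (c - 2 - b) + splitSum τ N g m b (c - 2 - b)) := by
  have e1 : ∑ a : Fin m → Fin N, oddWeight a * ∑ i, (2 * (toInt a i : ℝ) + 1) *
        ttau τ g m (Function.update (toInt a) i (c + toInt a i - 1))
      = m * ∑ x : Fin N, onePoint τ N g (m - 1) (c + ((x : ℕ) : ℤ) - 1) := by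
    cases m with
    | zero => simp
    | succ m => simpa using h.sum_oddWeight_mul_ttau_update N g m c
  have e2 : ∀ b : ℤ, ∑ a : Fin m → Fin N, oddWeight a *
      ∑ g₁ ∈ Finset.Icc (0 : ℤ) g, ∑ A ∈ (univ : Finset (Fin m)).powerset,
        (if 0 < 2 * g₁ - 1 + (A.card : ℤ) ∧ 0 < 2 * (g - g₁) - 1 + ((Aᶜ).card : ℤ) then
          ttau τ g₁ (A.card + 1) (Fin.cons b (fun j => toInt a (A.orderIsoOfFin rfl j).1))
          * ttau τ (g - g₁) ((Aᶜ).card + 1)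
              (Fin.cons (c - 2 - b) (fun j => toInt a ((Aᶜ).orderIsoOfFin rfl j).1))
        else 0) = splitSum τ N g m b (c - 2 - b) := by
    intro b
    simp_rw [Finset.mul_sum]
    rw [Finset.sum_comm, splitSum]
    refine Finset.sum_congr rfl fun g₁ _ => ?_
    have hp := Finset.sum_powerset_apply_card (x := (univ : Finset (Fin m))) fun j : ℕ =>
      if 0 < 2 * g₁ - 1 + (j : ℤ) ∧ 0 < 2 * (g - g₁) - 1 + ((m - j : ℕ) : ℤ) then
        onePoint τ N g₁ j b * onePoint τ N (g - g₁) (m - j) (c - 2 - b)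
      else 0
    simp only [Finset.card_univ, Fintype.card_fin, nsmul_eq_mul] at hp
    rw [Finset.sum_comm, ← hp]
    refine Finset.sum_congr rfl fun A _ => ?_
    have hcard : (Aᶜ).card = m - A.card := by rw [Finset.card_compl, Fintype.card_fin]
    rw [← sum_oddWeight_mul_ttau_mul_ttau, ← hcard]
    split_ifs <;> simp
  rw [← e1, onePoint]
  simp_rw [h.dvv g m hg hgm c (toInt _) hc (toInt_nonneg _), mul_add (oddWeight _),
    Finset.sum_add_distrib, mul_left_comm (oddWeight _) (1 / 2 : ℝ), mul_add (oddWeight _)]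
  congr 1
  rw [← Finset.mul_sum, Finset.sum_add_distrib, ← Finset.sum_congr rfl fun b _ => e2 b]
  congr 2
  · simp_rw [Finset.mul_sum]
    exact Finset.sum_comm
  · rw [Finset.sum_comm]
    simp_rw [← Finset.mul_sum]

end Correlators

section Omega

variable {τ : ℤ → (n : ℕ) → (Fin n → ℤ) → ℝ}

lemma dfac_two_mul_add_one (k : ℕ) :
    dfac (2 * (k : ℤ) + 1) = (2 * (k : ℝ) + 1) * dfac (2 * (k : ℤ) - 1) := by
  cases k with
  | zero => simp [dfac]
  | succ k =>
    have h1 : (2 * ((k + 1 : ℕ) : ℤ) + 1).toNat = 2 * k + 1 + 2 := by omega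
    have h2 : (2 * ((k + 1 : ℕ) : ℤ) - 1).toNat = 2 * k + 1 := by omega
    rw [dfac, dfac, h1, h2, Nat.doubleFactorial_add_two]
    push_cast
    ring

lemma DVVFamily.OmegaF_eq_sum (h : DVVFamily τ) {g : ℤ} {n N : ℕ}
    (hN : (3 * g + n - 3).toNat + 1 ≤ N) (w : Fin n → ℝ) :
    OmegaF τ g n w = ∑ a : Fin n → Fin N, τ g n (toInt a)
      * ∏ i, dfac (2 * ((a i : ℕ) : ℤ) - 1) * w i ^ (((a i : ℕ) : ℝ) + 1 / 2) := by
  refine Fintype.sum_of_injective (fun a i => Fin.castLE hN (a i)) ?_ _ _ ?_ fun a => rfl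
  · intro a b hab
    ext i
    simpa using congrArg (fun f => ((f i : Fin N) : ℕ)) hab
  · intro a ha
    rw [h.vanish, zero_mul]
    rintro ⟨-, -, hs⟩
    refine ha ⟨fun i => ⟨(a i : ℕ), ?_⟩, rfl⟩
    have := Finset.single_le_sum (f := toInt a) (fun j _ => toInt_nonneg a j) (Finset.mem_univ i)
    simp only [toInt] at this hs
    omega

lemma prod_dfac_mul_rpow {m N : ℕ} {w : ℝ} (hw : 0 < w) (a : Fin m → Fin N) :
    ∏ i, dfac (2 * ((a i : ℕ) : ℤ) - 1) * w ^ (((a i : ℕ) : ℝ) + 1 / 2)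
      = oddWeight a * (∏ i, dfac (2 * toInt a i + 1))
        * w ^ (((∑ i, toInt a i : ℤ) : ℝ) + m / 2) := by
  have hexp : ((∑ i, toInt a i : ℤ) : ℝ) + m / 2 = ∑ i, (((a i : ℕ) : ℝ) + 1 / 2) := by
    simp [Finset.sum_add_distrib, toInt]
    ring
  rw [hexp, Real.rpow_sum_of_pos hw, oddWeight, ← Finset.prod_mul_distrib,
    ← Finset.prod_mul_distrib]
  refine Finset.prod_congr rfl fun i _ => ?_
  rw [toInt, dfac_two_mul_add_one]
  have : (2 * ((a i : ℕ) : ℝ) + 1) ≠ 0 := by positivity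
  field_simp

lemma sum_consEquiv {m N : ℕ} (F : (Fin (m + 1) → Fin N) → ℝ) :
    ∑ a, F a = ∑ c : Fin N, ∑ a : Fin m → Fin N, F (Fin.cons c a) := by
  rw [← Equiv.sum_comp (Fin.consEquiv fun _ => Fin N), Fintype.sum_prod_type]
  rfl

lemma toInt_cons {m N : ℕ} (c : Fin N) (a : Fin m → Fin N) :
    toInt (Fin.cons c a : Fin (m + 1) → Fin N) = Fin.cons ((c : ℕ) : ℤ) (toInt a) := by
  simpa using toInt_insertNth 0 c a

/-- The coefficient of `x^{c+1/2}` in `Ω_{g,m+1}(x,w,…,w)`. -/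
noncomputable def omegaCoeff (τ : ℤ → (n : ℕ) → (Fin n → ℤ) → ℝ) (N : ℕ) (w : ℝ) (g : ℤ) (m : ℕ)
    (c : Fin N) : ℝ :=
  ∑ a : Fin m → Fin N, τ g (m + 1) (Fin.cons ((c : ℕ) : ℤ) (toInt a)) *
    (dfac (2 * ((c : ℕ) : ℤ) - 1) *
      ∏ i, dfac (2 * ((a i : ℕ) : ℤ) - 1) * w ^ (((a i : ℕ) : ℝ) + 1 / 2))

/-- The coefficient of `x^{c+1/2}y^{d+1/2}` in `Ω_{g,m+2}(x,y,w,…,w)`. -/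
noncomputable def omegaCoeff₂ (τ : ℤ → (n : ℕ) → (Fin n → ℤ) → ℝ) (N : ℕ) (w : ℝ) (g : ℤ) (m : ℕ)
    (c d : Fin N) : ℝ :=
  ∑ a : Fin m → Fin N, τ g (m + 2) (Fin.cons ((c : ℕ) : ℤ) (Fin.cons ((d : ℕ) : ℤ) (toInt a))) *
    (dfac (2 * ((c : ℕ) : ℤ) - 1) * (dfac (2 * ((d : ℕ) : ℤ) - 1) *
      ∏ i, dfac (2 * ((a i : ℕ) : ℤ) - 1) * w ^ (((a i : ℕ) : ℝ) + 1 / 2)))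

lemma DVVFamily.OmegaF_cons (h : DVVFamily τ) {g : ℤ} {m N : ℕ}
    (hN : (3 * g + (m + 1 : ℕ) - 3).toNat + 1 ≤ N) (w t : ℝ) :
    OmegaF τ g (m + 1) (Fin.cons t (fun _ : Fin m => w))
      = ∑ c : Fin N, omegaCoeff τ N w g m c * t ^ (((c : ℕ) : ℝ) + 1 / 2) := by
  rw [h.OmegaF_eq_sum hN, sum_consEquiv]
  refine Finset.sum_congr rfl fun c _ => ?_
  rw [omegaCoeff, Finset.sum_mul]
  refine Finset.sum_congr rfl fun a _ => ?_
  rw [toInt_cons, Fin.prod_univ_succ]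
  simp only [Fin.cons_zero, Fin.cons_succ]
  ring

lemma DVVFamily.OmegaF_cons_cons (h : DVVFamily τ) {g : ℤ} {m N : ℕ}
    (hN : (3 * g + (m + 2 : ℕ) - 3).toNat + 1 ≤ N) (w s t : ℝ) :
    OmegaF τ g (m + 2) (Fin.cons s (Fin.cons t (fun _ : Fin m => w)))
      = ∑ d : Fin N, (∑ c : Fin N, omegaCoeff₂ τ N w g m c d * s ^ (((c : ℕ) : ℝ) + 1 / 2))
          * t ^ (((d : ℕ) : ℝ) + 1 / 2) := by
  rw [h.OmegaF_eq_sum hN, sum_consEquiv]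
  simp_rw [sum_consEquiv, Finset.sum_mul]
  rw [Finset.sum_comm]
  refine Finset.sum_congr rfl fun d _ => Finset.sum_congr rfl fun c _ => ?_
  rw [omegaCoeff₂, Finset.sum_mul, Finset.sum_mul]
  refine Finset.sum_congr rfl fun a _ => ?_
  rw [toInt_cons, toInt_cons, Fin.prod_univ_succ, Fin.prod_univ_succ]
  simp only [Fin.cons_zero, Fin.cons_succ]
  ring

lemma DVVFamily.omegaCoeff_mul_rpow (h : DVVFamily τ) {N : ℕ} {w : ℝ} (hw : 0 < w) (g : ℤ) (m : ℕ)
    (c : Fin N) :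
    omegaCoeff τ N w g m c * (((c : ℕ) : ℝ) + 1 / 2) * w ^ (((c : ℕ) : ℝ) + 2)
      = 1 / 2 * w ^ (3 / 2 * (2 * (g : ℝ) + m)) * onePoint τ N g m ((c : ℕ) : ℤ) := by
  rw [omegaCoeff, onePoint, Finset.sum_mul, Finset.sum_mul, Finset.mul_sum]
  refine Finset.sum_congr rfl fun a _ => ?_
  by_cases ht : ((c : ℕ) : ℤ) + ∑ i, toInt a i = 3 * g - 3 + (m + 1 : ℕ)
  · have hexp : 3 / 2 * (2 * (g : ℝ) + m)
        = (((∑ i, toInt a i : ℤ) : ℝ) + m / 2) + (((c : ℕ) : ℝ) + 2) := by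
      have := congrArg (fun z : ℤ => (z : ℝ)) ht
      push_cast at this ⊢
      linarith
    rw [hexp, Real.rpow_add hw _ (((c : ℕ) : ℝ) + 2), ttau, Fin.prod_univ_succ,
      prod_dfac_mul_rpow hw]
    simp only [Fin.cons_zero, Fin.cons_succ, dfac_two_mul_add_one]
    ring
  · have h0 : τ g (m + 1) (Fin.cons ((c : ℕ) : ℤ) (toInt a)) = 0 :=
      h.vanish _ _ _ fun hh => ht (by simpa [Fin.sum_cons] using hh.2.2)
    simp [ttau, h0]

lemma DVVFamily.omegaCoeff₂_mul_rpow (h : DVVFamily τ) {N : ℕ} {w : ℝ} (hw : 0 < w) (g : ℤ)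
    (m : ℕ) (c d : Fin N) :
    omegaCoeff₂ τ N w g m c d * (((c : ℕ) : ℝ) + 1 / 2) * w ^ (((c : ℕ) : ℝ) + 2)
        * ((((d : ℕ) : ℝ) + 1 / 2) * w ^ (((d : ℕ) : ℝ) + 2))
      = 1 / 4 * w ^ (3 / 2 * (2 * (g : ℝ) + m + 2))
        * twoPoint τ N g m ((c : ℕ) : ℤ) ((d : ℕ) : ℤ) := by
  rw [omegaCoeff₂, twoPoint, Finset.sum_mul, Finset.sum_mul, Finset.sum_mul, Finset.mul_sum]
  refine Finset.sum_congr rfl fun a _ => ?_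
  by_cases ht : ((c : ℕ) : ℤ) + (((d : ℕ) : ℤ) + ∑ i, toInt a i) = 3 * g - 3 + (m + 2 : ℕ)
  · have hexp : 3 / 2 * (2 * (g : ℝ) + m + 2)
        = (((∑ i, toInt a i : ℤ) : ℝ) + m / 2) + (((c : ℕ) : ℝ) + 2) + (((d : ℕ) : ℝ) + 2) := by
      have := congrArg (fun z : ℤ => (z : ℝ)) ht
      push_cast at this ⊢
      linarith
    rw [hexp, Real.rpow_add hw _ (((d : ℕ) : ℝ) + 2), Real.rpow_add hw _ (((c : ℕ) : ℝ) + 2),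
      ttau, Fin.prod_univ_succ, Fin.prod_univ_succ, prod_dfac_mul_rpow hw]
    simp only [Fin.cons_zero, Fin.cons_succ, dfac_two_mul_add_one]
    ring
  · have h0 : τ g (m + 2) (Fin.cons ((c : ℕ) : ℤ) (Fin.cons ((d : ℕ) : ℤ) (toInt a))) = 0 :=
      h.vanish _ _ _ fun hh => ht (by simpa [Fin.sum_cons] using hh.2.2)
    simp [ttau, h0]

lemma rpow_mul_deriv_sum_rpow {N : ℕ} (K : Fin N → ℝ) (p : ℝ) {x : ℝ} (hx : 0 < x) :
    x ^ ((5 : ℝ) / 2) * deriv (fun t => ∑ c : Fin N, K c * t ^ (((c : ℕ) : ℝ) + p)) x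
      = ∑ c : Fin N, K c * (((c : ℕ) : ℝ) + p) * x ^ (((c : ℕ) : ℝ) + (p + 3 / 2)) := by
  have hd : HasDerivAt (fun t => ∑ c : Fin N, K c * t ^ (((c : ℕ) : ℝ) + p))
      (∑ c : Fin N, K c * ((((c : ℕ) : ℝ) + p) * x ^ (((c : ℕ) : ℝ) + p - 1))) x :=
    HasDerivAt.fun_sum fun c _ =>
      (Real.hasDerivAt_rpow_const (Or.inl hx.ne')).const_mul (K c)
  rw [hd.deriv, Finset.mul_sum]
  refine Finset.sum_congr rfl fun c _ => ?_
  have : ((c : ℕ) : ℝ) + (p + 3 / 2) = 5 / 2 + (((c : ℕ) : ℝ) + p - 1) := by ring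
  rw [this, Real.rpow_add hx]
  ring

lemma DVVFamily.Aterm_eq (h : DVVFamily τ) {N g m : ℕ} (hN : 3 * g + m ≤ N) (hN0 : 0 < N)
    {w : ℝ} (hw : 0 < w) :
    Aterm τ w g m = 1 / 2 * w ^ (3 / 2 * (2 * (g : ℝ) + m))
      * ∑ c : Fin N, onePoint τ N g m ((c : ℕ) : ℤ) := by
  have hN' : (3 * (g : ℤ) + (m + 1 : ℕ) - 3).toNat + 1 ≤ N := by omega
  rw [Aterm]
  simp_rw [h.OmegaF_cons hN']
  rw [rpow_mul_deriv_sum_rpow _ _ hw, Finset.mul_sum]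
  refine Finset.sum_congr rfl fun c _ => ?_
  have := h.omegaCoeff_mul_rpow hw g m c
  rw [Int.cast_natCast] at this
  rw [← this]
  norm_num

lemma DVVFamily.Bterm_eq (h : DVVFamily τ) {N g m : ℕ} (hN : 3 * g + m ≤ N) (hN0 : 0 < N)
    {w : ℝ} (hw : 0 < w) :
    Bterm τ w g m = 1 / 2 * w ^ (3 / 2 * (2 * (g : ℝ) + m + 1))
      * ∑ c : Fin N, (((c : ℕ) : ℝ) + 2) * onePoint τ N g m ((c : ℕ) : ℤ) := by
  have hN' : (3 * (g : ℤ) + (m + 1 : ℕ) - 3).toNat + 1 ≤ N := by omega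
  rw [Bterm]
  simp_rw [h.OmegaF_cons hN']
  have hev : (fun x => x ^ ((5 : ℝ) / 2) * deriv (fun t => ∑ c : Fin N,
      omegaCoeff τ N w g m c * t ^ (((c : ℕ) : ℝ) + 1 / 2)) x) =ᶠ[nhds w]
      fun x => ∑ c : Fin N, omegaCoeff τ N w g m c * (((c : ℕ) : ℝ) + 1 / 2) *
        x ^ (((c : ℕ) : ℝ) + (1 / 2 + 3 / 2)) := by
    filter_upwards [lt_mem_nhds hw] with x hx using rpow_mul_deriv_sum_rpow _ _ hx
  rw [hev.deriv_eq, rpow_mul_deriv_sum_rpow _ _ hw, Finset.mul_sum]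
  refine Finset.sum_congr rfl fun c _ => ?_
  have := h.omegaCoeff_mul_rpow hw g m c
  rw [Int.cast_natCast] at this
  have e1 : ((c : ℕ) : ℝ) + (1 / 2 + 3 / 2 + 3 / 2) = (((c : ℕ) : ℝ) + 2) + 3 / 2 := by ring
  have e2 : 3 / 2 * (2 * (g : ℝ) + m + 1) = 3 / 2 * (2 * (g : ℝ) + m) + 3 / 2 := by ring
  rw [e1, e2, Real.rpow_add hw _ ((3 : ℝ) / 2), Real.rpow_add hw _ ((3 : ℝ) / 2)]
  linear_combination (((c : ℕ) : ℝ) + 2) * w ^ ((3 : ℝ) / 2) * this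

lemma DVVFamily.Cterm_eq (h : DVVFamily τ) {N g m : ℕ} (hN : 3 * g + m ≤ N) (hN0 : 0 < N)
    {w : ℝ} (hw : 0 < w) :
    Cterm τ w g m = 1 / 4 * w ^ (3 / 2 * (2 * (g : ℝ) + m + 2))
      * ∑ c : Fin N, ∑ d : Fin N, twoPoint τ N g m ((c : ℕ) : ℤ) ((d : ℕ) : ℤ) := by
  have hN' : (3 * (g : ℤ) + (m + 2 : ℕ) - 3).toNat + 1 ≤ N := by omega
  rw [Cterm]
  simp_rw [h.OmegaF_cons_cons hN']
  rw [mul_assoc, ← deriv_const_mul_field]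
  simp_rw [rpow_mul_deriv_sum_rpow _ _ hw]
  have hswap : (fun x : ℝ => ∑ d : Fin N,
      (∑ c : Fin N, omegaCoeff₂ τ N w g m c d * x ^ (((c : ℕ) : ℝ) + 1 / 2))
        * (((d : ℕ) : ℝ) + 1 / 2) * w ^ (((d : ℕ) : ℝ) + (1 / 2 + 3 / 2)))
      = fun x => ∑ c : Fin N, (∑ d : Fin N, omegaCoeff₂ τ N w g m c d *
        ((((d : ℕ) : ℝ) + 1 / 2) * w ^ (((d : ℕ) : ℝ) + 2))) * x ^ (((c : ℕ) : ℝ) + 1 / 2) := by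
    ext x
    simp_rw [Finset.sum_mul]
    rw [Finset.sum_comm]
    refine Finset.sum_congr rfl fun c _ => Finset.sum_congr rfl fun d _ => ?_
    norm_num
    ring
  rw [hswap, rpow_mul_deriv_sum_rpow _ _ hw, Finset.mul_sum]
  refine Finset.sum_congr rfl fun c _ => ?_
  rw [Finset.sum_mul, Finset.sum_mul, Finset.mul_sum]
  refine Finset.sum_congr rfl fun d _ => ?_
  have := h.omegaCoeff₂_mul_rpow hw g m c d
  rw [Int.cast_natCast] at this
  rw [← this]
  norm_num
  ring

end Omega

section EraseSum

/-- The sum `∑_{x ∈ s} f x (s - x)` over the elements of a multiset. -/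
def eraseSum (s : Multiset ℤ) (f : ℤ → Multiset ℤ → ℝ) : ℝ :=
  (s.map fun x => f x (s.erase x)).sum

/-- The sum of `F p q` over all decompositions `s = p + q`. -/
def antidiagSum (s : Multiset ℤ) (F : Multiset ℤ → Multiset ℤ → ℝ) : ℝ :=
  (s.antidiagonal.map fun p => F p.1 p.2).sum

@[simp]
lemma eraseSum_zero (f : ℤ → Multiset ℤ → ℝ) : eraseSum 0 f = 0 := by simp [eraseSum]

lemma eraseSum_congr {s : Multiset ℤ} {f f' : ℤ → Multiset ℤ → ℝ}
    (hf : ∀ x t, x ::ₘ t = s → f x t = f' x t) : eraseSum s f = eraseSum s f' :=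
  congrArg Multiset.sum <| Multiset.map_congr rfl fun _ hx => hf _ _ (Multiset.cons_erase hx)

lemma eraseSum_cons (a : ℤ) (s : Multiset ℤ) (f : ℤ → Multiset ℤ → ℝ) :
    eraseSum (a ::ₘ s) f = f a s + eraseSum s fun x t => f x (a ::ₘ t) := by
  rw [eraseSum, Multiset.map_cons, Multiset.sum_cons, Multiset.erase_cons_head, eraseSum]
  congr 2
  exact Multiset.map_congr rfl fun x hx => by rw [Multiset.erase_cons_tail_of_mem hx]

lemma eraseSum_add (s : Multiset ℤ) (f f' : ℤ → Multiset ℤ → ℝ) :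
    (eraseSum s fun x t => f x t + f' x t) = eraseSum s f + eraseSum s f' :=
  Multiset.sum_map_add

lemma eraseSum_mul_left (s : Multiset ℤ) (c : ℝ) (f : ℤ → Multiset ℤ → ℝ) :
    (eraseSum s fun x t => c * f x t) = c * eraseSum s f :=
  Multiset.sum_map_mul_left

lemma eraseSum_eq_zero {s : Multiset ℤ} {f : ℤ → Multiset ℤ → ℝ}
    (hf : ∀ x t, x ::ₘ t = s → f x t = 0) : eraseSum s f = 0 := by
  rw [eraseSum_congr (f' := fun _ _ => 0) hf, eraseSum, Multiset.sum_map_zero]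

@[simp]
lemma antidiagSum_zero (F : Multiset ℤ → Multiset ℤ → ℝ) : antidiagSum 0 F = F 0 0 := by
  simp [antidiagSum]

lemma antidiagSum_congr {s : Multiset ℤ} {F F' : Multiset ℤ → Multiset ℤ → ℝ}
    (hF : ∀ p q, p + q = s → F p q = F' p q) : antidiagSum s F = antidiagSum s F' :=
  congrArg Multiset.sum <| Multiset.map_congr rfl fun _ hp =>
    hF _ _ (Multiset.mem_antidiagonal.1 hp)

lemma antidiagSum_cons (a : ℤ) (s : Multiset ℤ) (F : Multiset ℤ → Multiset ℤ → ℝ) :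
    antidiagSum (a ::ₘ s) F =
      (antidiagSum s fun p q => F p (a ::ₘ q)) + antidiagSum s fun p q => F (a ::ₘ p) q := by
  simp [antidiagSum, Multiset.antidiagonal_cons]

lemma antidiagSum_swap (s : Multiset ℤ) (F : Multiset ℤ → Multiset ℤ → ℝ) :
    antidiagSum s F = antidiagSum s fun p q => F q p := by
  rw [antidiagSum, ← Multiset.map_swap_antidiagonal, Multiset.map_map, antidiagSum]
  rfl

lemma antidiagSum_add (s : Multiset ℤ) (F F' : Multiset ℤ → Multiset ℤ → ℝ) :
    (antidiagSum s fun p q => F p q + F' p q) = antidiagSum s F + antidiagSum s F' :=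
  Multiset.sum_map_add

lemma antidiagSum_mul_left (s : Multiset ℤ) (c : ℝ) (F : Multiset ℤ → Multiset ℤ → ℝ) :
    (antidiagSum s fun p q => c * F p q) = c * antidiagSum s F :=
  Multiset.sum_map_mul_left

lemma antidiagSum_ite_eq_zero (s : Multiset ℤ) (f : Multiset ℤ → ℝ) :
    (antidiagSum s fun p q => if p = 0 then f q else 0) = f s := by
  induction s using Multiset.induction generalizing f with
  | empty => simp
  | cons a s ih =>
    rw [antidiagSum_cons, ih fun q => f (a ::ₘ q)]
    simp [antidiagSum]

lemma antidiagSum_eraseSum (s : Multiset ℤ) (φ : ℤ → Multiset ℤ → Multiset ℤ → ℝ) :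
    (antidiagSum s fun p q => eraseSum p fun x r => φ x r q) =
      eraseSum s fun x t => antidiagSum t fun r q => φ x r q := by
  induction s using Multiset.induction generalizing φ with
  | empty => simp
  | cons a s ih =>
    simp only [antidiagSum_cons, eraseSum_cons, antidiagSum_add, eraseSum_add]
    rw [ih fun x r q => φ x r (a ::ₘ q), ih fun x r q => φ x (a ::ₘ r) q]
    ring

lemma eraseSum_comm (s : Multiset ℤ) (φ : ℤ → ℤ → Multiset ℤ → ℝ) :
    (eraseSum s fun x t => eraseSum t fun z u => φ x z u) =
      eraseSum s fun x t => eraseSum t fun z u => φ z x u := by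
  induction s using Multiset.induction generalizing φ with
  | empty => simp
  | cons a s ih =>
    simp only [eraseSum_cons, eraseSum_add]
    rw [ih fun x z u => φ x z (a ::ₘ u)]
    ring

lemma sum_powerset_eq_antidiagSum {n : ℕ} (a : Fin n → ℤ) (F : Multiset ℤ → Multiset ℤ → ℝ)
    (S : Finset (Fin n)) :
    ∑ A ∈ S.powerset, F (A.val.map a) ((S \ A).val.map a) = antidiagSum (S.val.map a) F := by
  induction S using Finset.induction_on generalizing F with
  | empty => simp
  | insert i S hi ih =>
    rw [Finset.sum_powerset_insert hi, Finset.insert_val_of_notMem hi, Multiset.map_cons,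
      antidiagSum_cons, ← ih, ← ih]
    congr 1 <;> refine Finset.sum_congr rfl fun A hA => ?_
    · have hiA : i ∉ A := fun h' => hi (Finset.mem_powerset.1 hA h')
      rw [Finset.insert_sdiff_of_notMem _ hiA, Finset.insert_val_of_notMem, Multiset.map_cons]
      exact fun h' => hi (Finset.mem_sdiff.1 h').1
    · have hiA : i ∉ A := fun h' => hi (Finset.mem_powerset.1 hA h')
      rw [Finset.insert_val_of_notMem hiA, Multiset.map_cons, Finset.insert_sdiff_insert,
        Finset.sdiff_insert_of_notMem hi]

end EraseSum

section GenusZero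

variable {τ : ℤ → (n : ℕ) → (Fin n → ℤ) → ℝ}

/-- The rescaled correlator as a function of the multiset of its indices. -/
noncomputable def corr (τ : ℤ → (n : ℕ) → (Fin n → ℤ) → ℝ) (g : ℤ) (s : Multiset ℤ) : ℝ :=
  ttau τ g s.card fun i => s.toList.get (i.cast s.length_toList.symm)

lemma map_univ_toList_get (s : Multiset ℤ) :
    (univ : Finset (Fin s.card)).val.map
      (fun i => s.toList.get (i.cast s.length_toList.symm)) = s := by
  rw [Fin.univ_val_map]
  conv_rhs => rw [← s.coe_toList]
  congr 1
  apply List.ext_get <;> simp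

lemma exists_comp_perm_eq {n : ℕ} {a b : Fin n → ℤ}
    (hab : (univ : Finset (Fin n)).val.map a = univ.val.map b) :
    ∃ σ : Equiv.Perm (Fin n), b ∘ σ = a := by
  have key (c : ℤ) : Nonempty ({i // a i = c} ≃ {i // b i = c}) := by
    refine Fintype.card_eq.1 ?_
    have := congrArg (Multiset.count c) hab
    rw [Multiset.count_map, Multiset.count_map] at this
    rw [Fintype.card_subtype, Fintype.card_subtype]
    simpa [Finset.card_def, eq_comm] using this
  exact ⟨Equiv.ofFiberEquiv fun c => (key c).some, funext fun i => Equiv.ofFiberEquiv_map _ i⟩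

lemma DVVFamily.ttau_eq_corr (h : DVVFamily τ) (g : ℤ) {n : ℕ} (a : Fin n → ℤ)
    {s : Multiset ℤ} (hs : (univ : Finset (Fin n)).val.map a = s) :
    ttau τ g n a = corr τ g s := by
  obtain rfl : n = s.card := by simpa using congrArg Multiset.card hs
  obtain ⟨σ, hσ⟩ := exists_comp_perm_eq (hs.trans (map_univ_toList_get s).symm)
  rw [corr, ← hσ, h.ttau_comp_perm]

lemma map_univ_cons {n : ℕ} (x : ℤ) (a : Fin n → ℤ) :
    (univ : Finset (Fin (n + 1))).val.map (Fin.cons x a : Fin (n + 1) → ℤ) =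
      x ::ₘ univ.val.map a := by
  simp [Fin.univ_val_map]

lemma map_univ_update {n : ℕ} (a : Fin n → ℤ) (i : Fin n) (z : ℤ) :
    (univ : Finset (Fin n)).val.map (Function.update a i z) =
      z ::ₘ (univ.val.map a).erase (a i) := by
  have hu : (univ : Finset (Fin n)).val = i ::ₘ (univ.erase i).val := by
    rw [Finset.erase_val, Multiset.cons_erase (Finset.mem_univ i)]
  rw [hu, Multiset.map_cons, Multiset.map_cons, Multiset.erase_cons_head, Function.update_self]
  congr 1
  refine Multiset.map_congr rfl fun j hj => Function.update_of_ne ?_ _ _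
  exact Finset.ne_of_mem_erase (s := univ) hj

lemma map_univ_orderIsoOfFin {n : ℕ} (a : Fin n → ℤ) (A : Finset (Fin n)) :
    (univ : Finset (Fin A.card)).val.map (fun j => a (A.orderIsoOfFin rfl j).1) =
      A.val.map a := by
  have := congrArg (fun B => B.val.map a) (Finset.map_orderEmbOfFin_univ A rfl)
  rw [Finset.map_val, Multiset.map_map] at this
  exact this

lemma DVVFamily.corr_eq_zero (h : DVVFamily τ) {g : ℤ} {s : Multiset ℤ}
    (hs : ¬((∀ x ∈ s, 0 ≤ x) ∧ 0 < 2 * g - 2 + (s.card : ℤ) ∧ s.sum = 3 * g - 3 + s.card)) :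
    corr τ g s = 0 := by
  refine h.ttau_eq_zero fun hc => hs ⟨fun x hx => ?_, hc.2.1, ?_⟩
  · rw [← map_univ_toList_get s] at hx
    obtain ⟨i, -, rfl⟩ := Multiset.mem_map.1 hx
    exact hc.1 i
  · rw [← hc.2.2, Finset.sum, map_univ_toList_get]

lemma DVVFamily.corr_zero_recursion (h : DVVFamily τ) {c : ℤ} (hc : 0 ≤ c) {s : Multiset ℤ}
    (hs : ∀ x ∈ s, 0 ≤ x) (hs3 : 3 ≤ s.card) :
    corr τ 0 (c ::ₘ s) =
      (eraseSum s fun x t => (2 * (x : ℝ) + 1) * corr τ 0 ((c + x - 1) ::ₘ t)) +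
      (1 / 2) * ∑ b ∈ Finset.Icc (0 : ℤ) (c - 2),
        (corr τ (-1) (b ::ₘ (c - 2 - b) ::ₘ s) +
          antidiagSum s fun p q => corr τ 0 (b ::ₘ p) * corr τ 0 ((c - 2 - b) ::ₘ q)) := by
  obtain ⟨n, a, rfl⟩ : ∃ (n : ℕ) (a : Fin n → ℤ), univ.val.map a = s :=
    ⟨_, _, map_univ_toList_get s⟩
  have hn : 3 ≤ n := by simpa using hs3
  have ha (i : Fin n) : 0 ≤ a i := hs _ (Multiset.mem_map_of_mem a (Finset.mem_univ i))
  rw [← h.ttau_eq_corr 0 (Fin.cons c a) (map_univ_cons c a),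
    h.dvv 0 n le_rfl (by omega) c a hc ha]
  congr 1
  · rw [eraseSum, Multiset.map_map]
    refine congrArg Multiset.sum (Multiset.map_congr rfl fun i _ => ?_)
    rw [h.ttau_eq_corr 0 _ (map_univ_update a i _)]
    rfl
  · congr 1
    refine Finset.sum_congr rfl fun b _ => ?_
    rw [h.ttau_eq_corr (0 - 1) (s := b ::ₘ (c - 2 - b) ::ₘ univ.val.map a)
      _ (by rw [map_univ_cons, map_univ_cons]), zero_sub]
    congr 1
    rw [Finset.Icc_self, Finset.sum_singleton, ← sum_powerset_eq_antidiagSum]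
    refine Finset.sum_congr rfl fun A _ => ?_
    rw [sub_zero, ← h.ttau_eq_corr 0 (s := b ::ₘ A.val.map a)
        (Fin.cons b (fun j => a (A.orderIsoOfFin rfl j).1))
        (by rw [map_univ_cons, map_univ_orderIsoOfFin]),
      ← h.ttau_eq_corr 0 (s := (c - 2 - b) ::ₘ (univ \ A).val.map a)
        (Fin.cons (c - 2 - b) (fun j => a ((Aᶜ).orderIsoOfFin rfl j).1))
        (by rw [map_univ_cons, map_univ_orderIsoOfFin, Finset.compl_eq_univ_sdiff])]
    split_ifs with hst
    · rfl
    · rcases not_and_or.1 hst with hst | hst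
      · rw [h.ttau_eq_zero fun hz => hst (by have := hz.2.1; push_cast at this; linarith),
          zero_mul]
      · rw [mul_comm, h.ttau_eq_zero fun hz => hst (by have := hz.2.1; push_cast at this; linarith),
          zero_mul]

lemma DVVFamily.corr_neg_cons (h : DVVFamily τ) {g c : ℤ} (hc : c < 0) (s : Multiset ℤ) :
    corr τ g (c ::ₘ s) = 0 :=
  h.corr_eq_zero fun hz => absurd (hz.1 c (Multiset.mem_cons_self c s)) (not_le.2 hc)

lemma DVVFamily.corr_zero_string (h : DVVFamily τ) {s : Multiset ℤ} (hs : ∀ x ∈ s, 0 ≤ x)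
    (hs3 : 3 ≤ s.card) :
    corr τ 0 (0 ::ₘ s) =
      eraseSum s fun x t => (2 * (x : ℝ) + 1) * corr τ 0 ((x - 1) ::ₘ t) := by
  rw [h.corr_zero_recursion le_rfl hs hs3]
  simp

lemma DVVFamily.corr_zero_dilaton (h : DVVFamily τ) {s : Multiset ℤ} (hs : ∀ x ∈ s, 0 ≤ x)
    (hs3 : 3 ≤ s.card) :
    corr τ 0 (1 ::ₘ s) = eraseSum s fun x _ => (2 * (x : ℝ) + 1) * corr τ 0 s := by
  rw [h.corr_zero_recursion zero_le_one hs hs3]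
  simp only [Int.reduceSub, Int.reduceNeg, zero_lt_one, neg_neg_iff_pos, Finset.Icc_eq_empty_of_lt,
    Finset.sum_empty, mul_zero, add_zero]
  exact eraseSum_congr fun x t hxt => by rw [add_sub_cancel_left, hxt]

/-- The genus `-1` contribution `⟨τ̃_0 τ̃_0 ∏ τ̃_{a}⟩_{-1}` to the recursion. -/
noncomputable def negCorr (τ : ℤ → (n : ℕ) → (Fin n → ℤ) → ℝ) (s : Multiset ℤ) : ℝ :=
  corr τ (-1) (0 ::ₘ 0 ::ₘ s)

/-- The quadratic contribution `∑_{t = p + q} ⟨τ̃_0 τ̃_c ∏_p⟩_0 ⟨τ̃_0 ∏_q⟩_0`. -/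
noncomputable def splitCorr (τ : ℤ → (n : ℕ) → (Fin n → ℤ) → ℝ) (c : ℤ) (t : Multiset ℤ) : ℝ :=
  antidiagSum t fun p q => corr τ 0 (0 ::ₘ c ::ₘ p) * corr τ 0 (0 ::ₘ q)

lemma antidiagSum_cons_corr (c : ℤ) (t : Multiset ℤ) :
    (antidiagSum (c ::ₘ t) fun p q => corr τ 0 (0 ::ₘ p) * corr τ 0 (0 ::ₘ q)) =
      2 * splitCorr τ c t := by
  rw [antidiagSum_cons, antidiagSum_swap, splitCorr, two_mul]
  congr 1
  exact antidiagSum_congr fun p q _ => mul_comm _ _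

lemma DVVFamily.corr_zero_two (h : DVVFamily τ) {c : ℤ} {s : Multiset ℤ}
    (hs : ∀ x ∈ c ::ₘ s, 0 ≤ x) (hs3 : 2 ≤ s.card) :
    corr τ 0 (2 ::ₘ c ::ₘ s) =
      (eraseSum (c ::ₘ s) fun x t => (2 * (x : ℝ) + 1) * corr τ 0 ((x + 1) ::ₘ t)) +
      (1 / 2) * negCorr τ (c ::ₘ s) + splitCorr τ c s := by
  rw [h.corr_zero_recursion zero_le_two hs (by simpa using hs3), sub_self, Finset.Icc_self,
    Finset.sum_singleton, sub_self, antidiagSum_cons_corr, negCorr, mul_add, ← mul_assoc,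
    one_div_mul_cancel two_ne_zero, one_mul, ← add_assoc]
  congr 2
  exact eraseSum_congr fun x t _ => by rw [show 2 + x - 1 = x + 1 by ring]

lemma DVVFamily.corr_zero_two_pred (h : DVVFamily τ) {x : ℤ} {t : Multiset ℤ}
    (hs : ∀ z ∈ x ::ₘ t, 0 ≤ z) (hs3 : 2 ≤ t.card) :
    corr τ 0 (2 ::ₘ (x - 1) ::ₘ t) =
      (2 * (x : ℝ) - 1) * corr τ 0 (x ::ₘ t) +
      (eraseSum t fun z u => (2 * (z : ℝ) + 1) * corr τ 0 ((x - 1) ::ₘ (z + 1) ::ₘ u)) +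
      (1 / 2) * negCorr τ ((x - 1) ::ₘ t) + splitCorr τ (x - 1) t +
      if x = 0 then corr τ 0 (x ::ₘ t) else 0 := by
  by_cases hx : x = 0
  · subst hx
    have hneg (g : ℤ) (s : Multiset ℤ) (hs : (-1 : ℤ) ∈ s) : corr τ g s = 0 := by
      obtain ⟨u, rfl⟩ := Multiset.exists_cons_of_mem hs
      exact h.corr_neg_cons (by norm_num) u
    rw [eraseSum_eq_zero, negCorr, hneg 0 (2 ::ₘ _), hneg (-1), splitCorr, antidiagSum_congr (F' := fun _ _ => 0 * 0)]
    · simp [antidiagSum]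
    · intro p q _
      rw [hneg 0 (0 ::ₘ _), zero_mul, zero_mul]
      simp
    · simp
    · simp
    · intro z u _
      rw [hneg, mul_zero]
      simp
  · have hx0 := hs x (Multiset.mem_cons_self x t)
    rw [if_neg hx, add_zero, h.corr_zero_two, eraseSum_cons]
    · push_cast
      rw [sub_add_cancel, show 2 * ((x : ℝ) - 1) + 1 = 2 * x - 1 by ring,
        eraseSum_congr fun z u _ => by rw [Multiset.cons_swap]]
    · intro z hz
      rcases Multiset.mem_cons.1 hz with rfl | hz
      · omega
      · exact hs z (Multiset.mem_cons_of_mem hz)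
    · exact hs3

lemma DVVFamily.corr_zero_zero_cons (h : DVVFamily τ) {s : Multiset ℤ} (hs : ∀ x ∈ s, 0 ≤ x) :
    corr τ 0 (0 ::ₘ 0 ::ₘ s) = eraseSum s fun x t =>
      (2 * (x : ℝ) + 1) * corr τ 0 (0 ::ₘ (x - 1) ::ₘ t) +
        if t = 0 then (if x = 0 then corr τ 0 {0, 0, 0} else 0) else 0 := by
  rcases lt_trichotomy s.card 1 with hc | hc | hc
  · obtain rfl : s = 0 := Multiset.card_eq_zero.1 (by omega)
    rw [eraseSum_zero]
    exact h.corr_eq_zero fun hz => by simpa using hz.2.1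
  · obtain ⟨x, rfl⟩ := Multiset.card_eq_one.1 hc
    rw [← Multiset.cons_zero, eraseSum_cons, eraseSum_zero, if_pos rfl,
      h.corr_eq_zero (s := 0 ::ₘ (x - 1) ::ₘ 0) fun hz => by simpa using hz.2.1]
    split_ifs with hx
    · subst hx
      simp
    · rw [h.corr_eq_zero fun hz => hx (by simpa using hz.2.2)]
      simp
  · rw [h.corr_zero_string (s := 0 ::ₘ s) (by simpa using hs)
        (by rw [Multiset.card_cons]; omega), eraseSum_cons,
      h.corr_neg_cons (by norm_num), mul_zero, zero_add]
    refine eraseSum_congr fun x t hxt => ?_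
    rw [if_neg, add_zero, Multiset.cons_swap]
    rintro rfl
    simp [← hxt] at hc

lemma DVVFamily.splitCorr_zero (h : DVVFamily τ) {s : Multiset ℤ} (hs : ∀ x ∈ s, 0 ≤ x) :
    splitCorr τ 0 s = eraseSum s fun x t => (2 * (x : ℝ) + 1) * splitCorr τ (x - 1) t +
      corr τ 0 {0, 0, 0} * if x = 0 then corr τ 0 s else 0 := by
  rw [splitCorr, antidiagSum_congr (F' := fun p q => eraseSum p fun x t =>
    ((2 * (x : ℝ) + 1) * corr τ 0 (0 ::ₘ (x - 1) ::ₘ t) +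
        if t = 0 then (if x = 0 then corr τ 0 {0, 0, 0} else 0) else 0) * corr τ 0 (0 ::ₘ q)),
    antidiagSum_eraseSum]
  · refine eraseSum_congr fun x t hxt => ?_
    rw [splitCorr, ← antidiagSum_mul_left, ← hxt]
    have := antidiagSum_ite_eq_zero t fun q =>
      corr τ 0 {0, 0, 0} * if x = 0 then corr τ 0 (x ::ₘ q) else 0
    rw [← this, ← antidiagSum_add]
    refine antidiagSum_congr fun p q _ => ?_
    split_ifs with h1 h2
    · subst h2
      ring
    all_goals ring
  · intro p q hpq
    rw [h.corr_zero_zero_cons fun x hx => hs x (hpq ▸ Multiset.mem_add.2 (Or.inl hx)), mul_comm,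
      ← eraseSum_mul_left]
    exact eraseSum_congr fun x t _ => mul_comm _ _

lemma DVVFamily.negCorr_zero_cons (h : DVVFamily τ) {s : Multiset ℤ} (hs : ∀ x ∈ s, 0 ≤ x)
    (hs3 : 3 ≤ s.card) :
    negCorr τ (0 ::ₘ s) = eraseSum s fun x t => (2 * (x : ℝ) + 1) * negCorr τ ((x - 1) ::ₘ t) +
      2 * (1 - corr τ 0 {0, 0, 0}) * if x = 0 then corr τ 0 s else 0 := by
  have hs' : ∀ x ∈ 0 ::ₘ s, 0 ≤ x := by simpa using hs
  have hs2 : ∀ x ∈ 2 ::ₘ s, 0 ≤ x := by simpa using hs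
  have hL := h.corr_zero_two hs' (by omega)
  have hS := h.corr_zero_string hs2 (by rw [Multiset.card_cons]; omega)
  rw [Multiset.cons_swap, hS, eraseSum_cons, eraseSum_cons] at hL
  have e1 : (eraseSum s fun x t => (2 * (x : ℝ) + 1) * corr τ 0 ((x - 1) ::ₘ 2 ::ₘ t)) =
      eraseSum s fun x t => (2 * (x : ℝ) + 1) * ((2 * (x : ℝ) - 1) * corr τ 0 s +
      (eraseSum t fun z u => (2 * (z : ℝ) + 1) * corr τ 0 ((x - 1) ::ₘ (z + 1) ::ₘ u)) +
      (1 / 2) * negCorr τ ((x - 1) ::ₘ t) + splitCorr τ (x - 1) t +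
      if x = 0 then corr τ 0 s else 0) := by
    refine eraseSum_congr fun x t hxt => ?_
    rw [Multiset.cons_swap, h.corr_zero_two_pred (hxt ▸ hs), hxt]
    rw [← hxt, Multiset.card_cons] at hs3
    omega
  have e2 : (eraseSum s fun x t => (2 * (x : ℝ) + 1) * corr τ 0 ((x + 1) ::ₘ 0 ::ₘ t)) =
      eraseSum s fun x t => (2 * (x : ℝ) + 1) * ((2 * (x : ℝ) + 3) * corr τ 0 s +
      eraseSum t fun z u => (2 * (z : ℝ) + 1) * corr τ 0 ((z - 1) ::ₘ (x + 1) ::ₘ u)) := by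
    refine eraseSum_congr fun x t hxt => ?_
    rw [Multiset.cons_swap, h.corr_zero_string, eraseSum_cons, add_sub_cancel_right, hxt]
    · push_cast
      ring
    · intro z hz
      rcases Multiset.mem_cons.1 hz with rfl | hz
      · have := hs x (hxt ▸ Multiset.mem_cons_self x t)
        omega
      · exact hs z (hxt ▸ Multiset.mem_cons_of_mem hz)
    · rwa [← hxt, Multiset.card_cons, ← Multiset.card_cons (x + 1)] at hs3
  have e3 := eraseSum_comm s fun x z u => (2 * (x : ℝ) + 1) * (2 * (z : ℝ) + 1) *
    corr τ 0 ((x - 1) ::ₘ (z + 1) ::ₘ u)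
  have e4 := h.splitCorr_zero hs
  have e5 := h.corr_zero_dilaton hs hs3
  have e6 : (eraseSum s fun x t => (2 * (x : ℝ) + 1) * if x = 0 then corr τ 0 s else 0) =
      eraseSum s fun x t => if x = 0 then corr τ 0 s else 0 := by
    refine eraseSum_congr fun x t _ => ?_
    split_ifs with hx
    · simp [hx]
    · simp
  rw [show (2 : ℤ) - 1 = 1 by norm_num, show (0 : ℤ) + 1 = 1 by norm_num, e1, e2] at hL
  have e7 : (eraseSum s fun x t => (2 * (x : ℝ) + 1) * ((2 * (x : ℝ) - 1) * corr τ 0 s)) =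
      (eraseSum s fun x t => (2 * (x : ℝ) + 1) * ((2 * (x : ℝ) + 3) * corr τ 0 s)) -
        4 * corr τ 0 (1 ::ₘ s) := by
    rw [e5, eq_sub_iff_add_eq, ← eraseSum_mul_left, ← eraseSum_add]
    exact eraseSum_congr fun x t _ => by ring
  have e8 : (eraseSum s fun x t => (2 * (x : ℝ) + 1) * (1 / 2 * negCorr τ ((x - 1) ::ₘ t))) =
      1 / 2 * eraseSum s fun x t => (2 * (x : ℝ) + 1) * negCorr τ ((x - 1) ::ₘ t) := by
    rw [← eraseSum_mul_left]
    exact eraseSum_congr fun x t _ => by ring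
  have e9 : (eraseSum s fun x t => (2 * (x : ℝ) + 1) * eraseSum t fun z u =>
        (2 * (z : ℝ) + 1) * corr τ 0 ((x - 1) ::ₘ (z + 1) ::ₘ u)) =
      eraseSum s fun x t => (2 * (x : ℝ) + 1) * eraseSum t fun z u =>
        (2 * (z : ℝ) + 1) * corr τ 0 ((z - 1) ::ₘ (x + 1) ::ₘ u) := by
    simp only [← eraseSum_mul_left, ← mul_assoc]
    rw [e3]
    exact eraseSum_congr fun x t _ => eraseSum_congr fun z u _ => by ring
  simp only [mul_add, eraseSum_add, eraseSum_mul_left] at hL e4 e6 e7 e8 e9 ⊢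
  push_cast at hL
  linarith

lemma DVVFamily.corr_zero_three_mul (h : DVVFamily τ) :
    corr τ 0 {0, 0, 0} * (1 - corr τ 0 {0, 0, 0}) = 0 := by
  have hneg (g : ℤ) (s : Multiset ℤ) : corr τ g (-1 ::ₘ s) = 0 := h.corr_neg_cons (by norm_num) s
  have hneg' (s : Multiset ℤ) : negCorr τ (-1 ::ₘ s) = 0 := by
    rw [negCorr, Multiset.cons_swap 0 (-1), Multiset.cons_swap, hneg]
  have h000 : corr τ 0 (0 ::ₘ 0 ::ₘ 0 ::ₘ 0) = corr τ 0 {0, 0, 0} := rfl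
  have c1 : corr τ 0 (1 ::ₘ 0 ::ₘ 0 ::ₘ 0 ::ₘ 0) = 3 * corr τ 0 {0, 0, 0} := by
    rw [h.corr_zero_dilaton (by simp) (by simp)]
    simp [-Multiset.cons_zero, eraseSum_cons, h000]
    ring
  have c2 : corr τ 0 (2 ::ₘ 0 ::ₘ 0 ::ₘ 0 ::ₘ 0 ::ₘ 0) = 15 * corr τ 0 {0, 0, 0} := by
    rw [Multiset.cons_swap, h.corr_zero_string (by simp) (by simp)]
    simp [-Multiset.cons_zero, eraseSum_cons, hneg, c1]
    ring
  have c3 : corr τ 0 (3 ::ₘ 0 ::ₘ 0 ::ₘ 0 ::ₘ 0 ::ₘ 0 ::ₘ 0) = 105 * corr τ 0 {0, 0, 0} := by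
    rw [Multiset.cons_swap, h.corr_zero_string (by simp) (by simp)]
    simp [-Multiset.cons_zero, eraseSum_cons, hneg, c2]
    ring
  have hE0 : negCorr τ (0 ::ₘ 0 ::ₘ 0 ::ₘ 0 ::ₘ 0) =
      6 * corr τ 0 {0, 0, 0} * (1 - corr τ 0 {0, 0, 0}) := by
    rw [h.negCorr_zero_cons (by simp) (by simp)]
    simp [-Multiset.cons_zero, eraseSum_cons, hneg', h000]
    ring
  have hE1 : negCorr τ (1 ::ₘ 0 ::ₘ 0 ::ₘ 0 ::ₘ 0 ::ₘ 0) =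
      36 * corr τ 0 {0, 0, 0} * (1 - corr τ 0 {0, 0, 0}) := by
    rw [Multiset.cons_swap, h.negCorr_zero_cons (by simp) (by simp)]
    simp [-Multiset.cons_zero, eraseSum_cons, hneg', c1, hE0]
    ring
  have z (k : ℕ) (hk : k ≠ 3) : corr τ 0 (Multiset.replicate k 0) = 0 :=
    h.corr_eq_zero fun hz => hk (by have := hz.2.2; simp at this; omega)
  have z1 := z 1 (by norm_num)
  have z2 := z 2 (by norm_num)
  have z4 := z 4 (by norm_num)
  have z5 := z 5 (by norm_num)
  have z6 := z 6 (by norm_num)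
  simp only [Multiset.replicate_succ, Multiset.replicate_zero] at z1 z2 z4 z5 z6
  have hQ : (antidiagSum (0 ::ₘ 0 ::ₘ 0 ::ₘ 0 ::ₘ 0 ::ₘ 0) fun p q =>
      corr τ 0 (0 ::ₘ p) * corr τ 0 (1 ::ₘ q)) = 30 * corr τ 0 {0, 0, 0} ^ 2 := by
    simp only [antidiagSum_cons, antidiagSum_zero, z1, z2, z4, z5, z6, c1, h000]
    ring
  have hQ' : (antidiagSum (0 ::ₘ 0 ::ₘ 0 ::ₘ 0 ::ₘ 0 ::ₘ 0) fun p q =>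
      corr τ 0 (1 ::ₘ p) * corr τ 0 (0 ::ₘ q)) = 30 * corr τ 0 {0, 0, 0} ^ 2 := by
    rw [antidiagSum_swap, ← hQ]
    exact antidiagSum_congr fun p q _ => mul_comm _ _
  have hE1' : corr τ (-1) (1 ::ₘ 0 ::ₘ 0 ::ₘ 0 ::ₘ 0 ::ₘ 0 ::ₘ 0 ::ₘ 0) =
      36 * corr τ 0 {0, 0, 0} * (1 - corr τ 0 {0, 0, 0}) := by
    rw [← hE1, negCorr, Multiset.cons_swap 0 1, Multiset.cons_swap 0 1]
  have hE1'' : corr τ (-1) (0 ::ₘ 1 ::ₘ 0 ::ₘ 0 ::ₘ 0 ::ₘ 0 ::ₘ 0 ::ₘ 0) =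
      36 * corr τ 0 {0, 0, 0} * (1 - corr τ 0 {0, 0, 0}) := by
    rw [Multiset.cons_swap 0 1, hE1']
  have hI : Finset.Icc (0 : ℤ) (3 - 2) = {0, 1} := by decide
  have key := h.corr_zero_recursion (c := 3) (by norm_num)
    (s := 0 ::ₘ 0 ::ₘ 0 ::ₘ 0 ::ₘ 0 ::ₘ 0) (by simp) (by simp)
  rw [hI, Finset.sum_pair zero_ne_one] at key
  simp only [eraseSum_cons, eraseSum_zero, Int.reduceSub, Int.reduceAdd, hE1', hE1'', hQ, hQ', c2,
    c3] at key
  push_cast at key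
  linarith

lemma exists_zero_cons {s : Multiset ℤ} (hs : ∀ x ∈ s, 0 ≤ x) (hsum : s.sum < s.card) :
    ∃ t, s = 0 ::ₘ t := by
  refine Multiset.exists_cons_of_mem (by_contra fun h0 => hsum.not_ge ?_)
  have := Multiset.card_nsmul_le_sum (s := s) (a := (1 : ℤ)) fun x hx => by
    have h1 := hs x hx
    have h2 : x ≠ 0 := fun h2 => h0 (h2 ▸ hx)
    omega
  simpa using this

lemma DVVFamily.one_sub_mul_corr_zero (h : DVVFamily τ) (s : Multiset ℤ) :
    (1 - corr τ 0 {0, 0, 0}) * corr τ 0 s = 0 := by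
  induction hk : s.card using Nat.strong_induction_on generalizing s with
  | _ k ih =>
  by_cases hs : (∀ x ∈ s, 0 ≤ x) ∧ 0 < 2 * 0 - 2 + (s.card : ℤ) ∧
    s.sum = 3 * 0 - 3 + (s.card : ℤ)
  swap
  · rw [h.corr_eq_zero hs, mul_zero]
  obtain ⟨h0, h1, h2⟩ := hs
  obtain ⟨t, rfl⟩ := exists_zero_cons h0 (by omega)
  have ht : ∀ x ∈ t, 0 ≤ x := fun x hx => h0 x (Multiset.mem_cons_of_mem hx)
  rw [Multiset.card_cons] at h1 h2 hk
  by_cases h3 : 3 ≤ t.card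
  · rw [h.corr_zero_string ht h3, ← eraseSum_mul_left]
    refine eraseSum_eq_zero fun x u hxu => ?_
    rw [mul_left_comm, ih (k - 1) (by omega), mul_zero]
    rw [← hxu, Multiset.card_cons] at hk
    rw [Multiset.card_cons]
    omega
  · obtain ⟨a, b, rfl⟩ := Multiset.card_eq_two.1 (show t.card = 2 by omega)
    have ha := ht a (by simp)
    have hb := ht b (by simp)
    simp at h2
    obtain rfl : a = 0 := by omega
    obtain rfl : b = 0 := by omega
    rw [mul_comm]
    exact h.corr_zero_three_mul

lemma DVVFamily.negCorr_eq_zero (h : DVVFamily τ) (s : Multiset ℤ) : negCorr τ s = 0 := by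
  induction hk : s.card using Nat.strong_induction_on generalizing s with
  | _ k ih =>
  by_contra hne
  obtain ⟨h0, -, h2⟩ := not_not.1 (mt h.corr_eq_zero hne)
  have hs : ∀ x ∈ s, 0 ≤ x := fun x hx =>
    h0 x (Multiset.mem_cons_of_mem (Multiset.mem_cons_of_mem hx))
  have hpos := Multiset.sum_nonneg hs
  simp only [Multiset.sum_cons, Multiset.card_cons] at h2
  push_cast at h2
  obtain ⟨t, rfl⟩ := exists_zero_cons hs (by omega)
  have ht : ∀ x ∈ t, 0 ≤ x := fun x hx => hs x (Multiset.mem_cons_of_mem hx)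
  rw [Multiset.sum_cons] at h2 hpos
  rw [Multiset.card_cons] at h2 hk
  refine hne ?_
  rw [h.negCorr_zero_cons ht (by omega)]
  refine eraseSum_eq_zero fun x u hxu => ?_
  rw [ih (k - 1) (by omega), mul_ite, mul_assoc, h.one_sub_mul_corr_zero]
  · simp
  · rw [← hxu, Multiset.card_cons] at hk
    rw [Multiset.card_cons]
    omega

lemma DVVFamily.corr_neg_one (h : DVVFamily τ) (s : Multiset ℤ) : corr τ (-1) s = 0 := by
  by_contra hne
  obtain ⟨h0, -, h2⟩ := not_not.1 (mt h.corr_eq_zero hne)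
  obtain ⟨t, rfl⟩ := exists_zero_cons h0 (by omega)
  have ht : ∀ x ∈ t, 0 ≤ x := fun x hx => h0 x (Multiset.mem_cons_of_mem hx)
  simp only [Multiset.sum_cons, Multiset.card_cons] at h2
  obtain ⟨u, rfl⟩ := exists_zero_cons ht (by omega)
  exact hne (h.negCorr_eq_zero u)

lemma DVVFamily.twoPoint_neg_one (h : DVVFamily τ) (N m : ℕ) (b c : ℤ) :
    twoPoint τ N (-1) m b c = 0 :=
  Finset.sum_eq_zero fun a _ => by rw [h.ttau_eq_corr _ _ rfl, h.corr_neg_one, mul_zero]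

end GenusZero

section Assembly

variable {τ : ℤ → (n : ℕ) → (Fin n → ℤ) → ℝ}

lemma sum_fin_fin (N : ℕ) (F : ℤ → ℤ → ℝ) :
    ∑ b : Fin N, ∑ d : Fin N, F ((b : ℕ) : ℤ) ((d : ℕ) : ℤ) =
      ∑ p ∈ Finset.range N ×ˢ Finset.range N, F (p.1 : ℤ) (p.2 : ℤ) := by
  simp only [Finset.sum_product, Finset.sum_range]

lemma sum_fin_add_sub_one (N : ℕ) (f : ℤ → ℝ) (hf : ∀ d : ℤ, ¬(0 ≤ d ∧ d + 1 < N) → f d = 0) :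
    ∑ c : Fin N, ∑ x : Fin N, f (((c : ℕ) : ℤ) + ((x : ℕ) : ℤ) - 1) =
      ∑ d : Fin N, (((d : ℕ) : ℝ) + 2) * f ((d : ℕ) : ℤ) := by
  have hR : ∀ d ∈ Finset.range N, ((d : ℝ) + 2) * f (d : ℤ) =
      ∑ _p ∈ antidiagonal (d + 1), f (d : ℤ) := fun d _ => by
    rw [Finset.sum_const, Finset.Nat.card_antidiagonal, nsmul_eq_mul]
    push_cast
    ring
  rw [Fin.sum_univ_eq_sum_range fun d => ((d : ℝ) + 2) * f (d : ℤ), Finset.sum_congr rfl hR,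
    sum_fin_fin N fun c x => f (c + x - 1), Finset.sum_sigma']
  have hmem (a : ℕ × ℕ) (ha : f ((a.1 : ℤ) + (a.2 : ℤ) - 1) ≠ 0) :
      1 ≤ a.1 + a.2 ∧ a.1 + a.2 < N := by
    have := not_not.1 (mt (hf _) ha)
    omega
  refine Finset.sum_bij_ne_zero (fun a _ _ => ⟨a.1 + a.2 - 1, a⟩) ?_ ?_ ?_ ?_
  · intro a _ ha
    have := hmem a ha
    simp only [Finset.mem_sigma, Finset.mem_range, Finset.HasAntidiagonal.mem_antidiagonal]
    omega
  · intro a _ _ b _ _ hab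
    simpa using (Sigma.mk.inj_iff.1 hab).2
  · rintro ⟨d, p⟩ hp hne
    simp only [Finset.mem_sigma, Finset.mem_range, Finset.HasAntidiagonal.mem_antidiagonal] at hp
    have hd := not_not.1 (mt (hf d) hne)
    have h1 : p.1 + p.2 - 1 = d := by omega
    refine ⟨p, ?_, ?_, by rw [h1]⟩
    · simp only [Finset.mem_product, Finset.mem_range]
      omega
    · rwa [show (p.1 : ℤ) + p.2 - 1 = d by omega]
  · intro a _ ha
    have := hmem a ha
    congr 1
    push_cast [this.1]
    ring

lemma sum_fin_sum_Icc (N : ℕ) (F : ℤ → ℤ → ℝ) (hF : ∀ b c : ℤ, N ≤ b + c + 2 → F b c = 0) :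
    ∑ c : Fin N, ∑ b ∈ Finset.Icc (0 : ℤ) (((c : ℕ) : ℤ) - 2), F b (((c : ℕ) : ℤ) - 2 - b) =
      ∑ b : Fin N, ∑ d : Fin N, F ((b : ℕ) : ℤ) ((d : ℕ) : ℤ) := by
  rw [Fin.sum_univ_eq_sum_range fun c =>
      ∑ b ∈ Finset.Icc (0 : ℤ) ((c : ℤ) - 2), F b ((c : ℤ) - 2 - b),
    sum_fin_fin, Finset.sum_sigma', eq_comm]
  refine Finset.sum_bij_ne_zero (fun a _ _ => ⟨a.1 + a.2 + 2, (a.1 : ℤ)⟩) ?_ ?_ ?_ ?_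
  · intro a _ ha
    have := mt (hF _ _) ha
    simp only [Finset.mem_sigma, Finset.mem_range, Finset.mem_Icc]
    omega
  · intro a _ _ b _ _ hab
    simp only [Sigma.mk.injEq, heq_eq_eq] at hab
    ext <;> omega
  · rintro ⟨c, b⟩ hp hne
    simp only [Finset.mem_sigma, Finset.mem_range, Finset.mem_Icc] at hp
    have h1 : ((b.toNat : ℕ) : ℤ) = b := by omega
    have h2 : (((c - 2 - b.toNat : ℕ) : ℕ) : ℤ) = (c : ℤ) - 2 - b := by omega
    refine ⟨(b.toNat, c - 2 - b.toNat), ?_, ?_, ?_⟩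
    · simp only [Finset.mem_product, Finset.mem_range]
      omega
    · simpa only [h1, h2] using hne
    · simp only [h1, Sigma.mk.injEq, heq_eq_eq, and_true]
      omega
  · intro a _ _
    congr 1
    push_cast
    ring

/-- The reindexing `(g₁ + g₂, j + k) ↔ (2g₁ + j, 2g₂ + k)` of fourfold sums with
`2(g₁ + g₂) + j + k = n`. -/
lemma sum_antidiagonal_reindex (n : ℕ) (F : ℕ → ℕ → ℕ → ℕ → ℝ) :
    (∑ g ∈ Finset.range (n + 1), if 2 * g ≤ n then
      ∑ x ∈ antidiagonal g, ∑ y ∈ antidiagonal (n - 2 * g), F x.1 y.1 x.2 y.2 else 0) =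
    ∑ i ∈ Finset.range (n + 1), ∑ g₁ ∈ Finset.range (i + 1), if 2 * g₁ ≤ i then
      ∑ g₂ ∈ Finset.range (n - i + 1), if 2 * g₂ ≤ n - i then
        F g₁ (i - 2 * g₁) g₂ (n - i - 2 * g₂) else 0 else 0 := by
  simp only [← Finset.sum_filter, Finset.sum_sigma']
  refine Finset.sum_bij'
    (fun a _ => ⟨2 * a.2.1.1 + a.2.2.1, a.2.1.1, a.2.1.2⟩)
    (fun b _ => ⟨b.2.1 + b.2.2, (b.2.1, b.2.2), (b.1 - 2 * b.2.1, n - b.1 - 2 * b.2.2)⟩)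
    ?_ ?_ ?_ ?_ ?_
  · rintro ⟨g, x, y⟩ ha
    simp only [Finset.mem_sigma, Finset.mem_filter, Finset.mem_range,
      Finset.HasAntidiagonal.mem_antidiagonal] at ha ⊢
    omega
  · rintro ⟨i, g₁, g₂⟩ ha
    simp only [Finset.mem_sigma, Finset.mem_filter, Finset.mem_range,
      Finset.HasAntidiagonal.mem_antidiagonal] at ha ⊢
    exact ⟨by omega, trivial, by omega⟩
  · rintro ⟨g, x, y⟩ ha
    simp only [Finset.mem_sigma, Finset.mem_filter, Finset.mem_range,
      Finset.HasAntidiagonal.mem_antidiagonal] at ha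
    obtain ⟨⟨h1, h2⟩, rfl, h4⟩ := ha
    simp only [Sigma.mk.injEq, heq_eq_eq, true_and, Prod.mk.eta, Prod.ext_iff]
    omega
  · rintro ⟨i, g₁, g₂⟩ ha
    simp only [Finset.mem_sigma, Finset.mem_filter, Finset.mem_range] at ha
    simp only [Sigma.mk.injEq, heq_eq_eq, and_true]
    omega
  · rintro ⟨g, x, y⟩ ha
    simp only [Finset.mem_sigma, Finset.mem_filter, Finset.mem_range,
      Finset.HasAntidiagonal.mem_antidiagonal] at ha
    congr 1 <;> simp only <;> omega

/-- The sum of `onePoint` over all values of its distinguished index. -/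
noncomputable def onePointSum (τ : ℤ → (n : ℕ) → (Fin n → ℤ) → ℝ) (N : ℕ) (g : ℤ) (m : ℕ) : ℝ :=
  ∑ c : Fin N, onePoint τ N g m ((c : ℕ) : ℤ)

lemma DVVFamily.splitSum_eq_zero (h : DVVFamily τ) {N m : ℕ} {g b c : ℤ}
    (hbc : 3 * g - 4 + m < b + c) : splitSum τ N g m b c = 0 := by
  refine Finset.sum_eq_zero fun g₁ _ => Finset.sum_eq_zero fun j hj => ?_
  have hj := Finset.mem_range.1 hj
  by_cases hb : b ≤ 3 * g₁ - 2 + j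
  · rw [h.onePoint_eq_zero (c := c), mul_zero, ite_self, mul_zero]
    rintro ⟨-, hc⟩
    push_cast [Nat.le_of_lt_succ hj] at hc
    linarith
  · rw [h.onePoint_eq_zero fun hz => hb hz.2, zero_mul, ite_self, mul_zero]

lemma sum_Icc_eq_sum_antidiagonal (g : ℕ) (φ : ℤ → ℤ → ℝ) :
    ∑ g₁ ∈ Finset.Icc (0 : ℤ) g, φ g₁ (g - g₁) = ∑ x ∈ antidiagonal g, φ x.1 x.2 := by
  refine Finset.sum_bij' (fun g₁ _ => (g₁.toNat, g - g₁.toNat)) (fun x _ => x.1) ?_ ?_ ?_ ?_ ?_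
  · intro g₁ hg
    rw [Finset.mem_Icc] at hg
    rw [Finset.HasAntidiagonal.mem_antidiagonal]
    omega
  · intro x hx
    rw [Finset.HasAntidiagonal.mem_antidiagonal] at hx
    rw [Finset.mem_Icc]
    omega
  · intro g₁ hg
    rw [Finset.mem_Icc] at hg
    exact Int.toNat_of_nonneg hg.1
  · intro x hx
    rw [Finset.HasAntidiagonal.mem_antidiagonal] at hx
    ext
    · exact Int.toNat_natCast _
    · simp only [Int.toNat_natCast]
      omega
  · intro g₁ hg
    rw [Finset.mem_Icc] at hg
    congr 1 <;> simp only <;> omega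

lemma sum_splitSum (N g m : ℕ) :
    ∑ b : Fin N, ∑ d : Fin N, splitSum τ N g m ((b : ℕ) : ℤ) ((d : ℕ) : ℤ) =
      ∑ x ∈ antidiagonal g, ∑ y ∈ antidiagonal m, (m.choose y.1 : ℝ) *
        if 2 ≤ 2 * x.1 + y.1 ∧ 2 ≤ 2 * x.2 + y.2 then
          onePointSum τ N x.1 y.1 * onePointSum τ N x.2 y.2 else 0 := by
  have e (b d : ℤ) : splitSum τ N g m b d =
      ∑ x ∈ antidiagonal g, ∑ y ∈ antidiagonal m, (m.choose y.1 : ℝ) *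
        if 2 ≤ 2 * x.1 + y.1 ∧ 2 ≤ 2 * x.2 + y.2 then
          onePoint τ N x.1 y.1 b * onePoint τ N x.2 y.2 d else 0 := by
    rw [splitSum, sum_Icc_eq_sum_antidiagonal g fun g₁ g₂ => ∑ j ∈ Finset.range (m + 1),
      (m.choose j : ℝ) * if 0 < 2 * g₁ - 1 + (j : ℤ) ∧ 0 < 2 * g₂ - 1 + ((m - j : ℕ) : ℤ) then
        onePoint τ N g₁ j b * onePoint τ N g₂ (m - j) d else 0]
    refine Finset.sum_congr rfl fun x _ => ?_
    rw [Finset.Nat.sum_antidiagonal_eq_sum_range_succ fun j k => (m.choose j : ℝ) *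
      if 2 ≤ 2 * x.1 + j ∧ 2 ≤ 2 * x.2 + k then
        onePoint τ N x.1 j b * onePoint τ N x.2 k d else 0]
    refine Finset.sum_congr rfl fun j _ => ?_
    congr 1
    exact if_congr (by omega) rfl rfl
  simp_rw [e]
  rw [← Finset.sum_product', Finset.sum_comm]
  refine Finset.sum_congr rfl fun x _ => ?_
  rw [Finset.sum_comm]
  refine Finset.sum_congr rfl fun y _ => ?_
  split_ifs
  · rw [← Finset.mul_sum, onePointSum, onePointSum, Finset.sum_mul_sum, Finset.sum_product]
  · simp

lemma DVVFamily.onePointSum_recursion (h : DVVFamily τ) {N g m : ℕ} (hgm : 3 ≤ 2 * g + m)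
    (hN : 3 * g + m ≤ N) :
    onePointSum τ N g m =
      m * ∑ c : Fin N, (((c : ℕ) : ℝ) + 2) * onePoint τ N g (m - 1) ((c : ℕ) : ℤ) +
      (1 / 2) * (∑ b : Fin N, ∑ d : Fin N, twoPoint τ N ((g : ℤ) - 1) m b d +
        ∑ x ∈ antidiagonal g, ∑ y ∈ antidiagonal m, (m.choose y.1 : ℝ) *
          if 2 ≤ 2 * x.1 + y.1 ∧ 2 ≤ 2 * x.2 + y.2 then
            onePointSum τ N x.1 y.1 * onePointSum τ N x.2 y.2 else 0) := by
  have hrec := fun c : Fin N => h.onePoint_recursion N (Int.natCast_nonneg g) m (by omega)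
    (Int.natCast_nonneg (c : ℕ))
  rw [onePointSum, Finset.sum_congr rfl fun c _ => hrec c, Finset.sum_add_distrib, ← Finset.mul_sum,
    ← Finset.mul_sum, sum_fin_sum_Icc N fun b d => twoPoint τ N ((g : ℤ) - 1) m b d +
      splitSum τ N g m b d, ← sum_splitSum]
  · simp_rw [Finset.sum_add_distrib]
    congr 1
    rcases Nat.eq_zero_or_pos m with rfl | hm
    · simp
    · rw [sum_fin_add_sub_one N fun d => onePoint τ N g (m - 1) d]
      intro d hd
      refine h.onePoint_eq_zero fun hz => hd ?_
      omega
  · intro b d hbd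
    rw [h.twoPoint_eq_zero (by omega), h.splitSum_eq_zero (by omega), add_zero]

/-- The diagonal sum `∑_{2g+m=i} onePointSum(g,m)/m!`, so that `diagSum τ w i = ½ w^{3i/2}` times
this number. -/
noncomputable def diagCoeff (τ : ℤ → (n : ℕ) → (Fin n → ℤ) → ℝ) (N i : ℕ) : ℝ :=
  ∑ g ∈ Finset.range (i + 1), if 2 * g ≤ i then
    onePointSum τ N g (i - 2 * g) / ((i - 2 * g).factorial : ℝ) else 0

lemma DVVFamily.diagSum_eq (h : DVVFamily τ) {N i : ℕ} (hN : 3 * i ≤ N) (hN0 : 0 < N) {w : ℝ}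
    (hw : 0 < w) : diagSum τ w i = 1 / 2 * w ^ (3 / 2 * (i : ℝ)) * diagCoeff τ N i := by
  rw [diagSum, diagCoeff, Finset.mul_sum]
  refine Finset.sum_congr rfl fun g _ => ?_
  split_ifs with hg
  · rw [h.Aterm_eq (N := N) (by omega) hN0 hw, onePointSum]
    push_cast [hg]
    rw [add_sub_cancel]
    ring
  · simp

lemma sum_antidiagonal_div_factorial (N n : ℕ) :
    (∑ g ∈ Finset.range (n + 1), if 2 * g ≤ n then
      (∑ x ∈ antidiagonal g, ∑ y ∈ antidiagonal (n - 2 * g), ((n - 2 * g).choose y.1 : ℝ) *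
        if 2 ≤ 2 * x.1 + y.1 ∧ 2 ≤ 2 * x.2 + y.2 then
          onePointSum τ N x.1 y.1 * onePointSum τ N x.2 y.2 else 0) /
        ((n - 2 * g).factorial : ℝ) else 0) =
    ∑ i ∈ Finset.range (n + 1),
      if 2 ≤ i ∧ 2 ≤ n - i then diagCoeff τ N i * diagCoeff τ N (n - i) else 0 := by
  have e := sum_antidiagonal_reindex n fun g₁ j g₂ k =>
    if 2 ≤ 2 * g₁ + j ∧ 2 ≤ 2 * g₂ + k then
      onePointSum τ N g₁ j / (j.factorial : ℝ) * (onePointSum τ N g₂ k / (k.factorial : ℝ)) else 0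
  convert e using 1
  · refine Finset.sum_congr rfl fun g _ => if_congr Iff.rfl ?_ rfl
    simp_rw [Finset.sum_div]
    refine Finset.sum_congr rfl fun x _ => Finset.sum_congr rfl fun y hy => ?_
    rw [Finset.HasAntidiagonal.mem_antidiagonal] at hy
    rw [← hy, Nat.choose_symm_add, Nat.add_choose]
    split_ifs
    · rw [Nat.cast_div (Nat.factorial_mul_factorial_dvd_factorial_add _ _)
        (by positivity)]
      push_cast
      field_simp
    · simp
  · refine Finset.sum_congr rfl fun i _ => ?_
    split_ifs with hi
    · rw [diagCoeff, diagCoeff, Finset.sum_mul]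
      refine Finset.sum_congr rfl fun g₁ _ => ?_
      split_ifs with hg₁
      · rw [Finset.mul_sum]
        refine Finset.sum_congr rfl fun g₂ _ => ?_
        split_ifs with hg₂ hc
        · rfl
        · omega
        · simp
      · simp
    · refine (Finset.sum_eq_zero fun g₁ _ => ?_).symm
      split_ifs with hg₁
      · refine Finset.sum_eq_zero fun g₂ _ => ?_
        split_ifs with hg₂ hc
        · omega
        · rfl
        · rfl
      · rfl

lemma DVVFamily.diagCoeff_recursion (h : DVVFamily τ) {N n : ℕ} (hn : 3 ≤ n) (hN : 3 * n ≤ N) :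
    diagCoeff τ N n =
      (∑ g ∈ Finset.range (n + 1), if 2 * g ≤ n - 1 then
        (∑ c : Fin N, (((c : ℕ) : ℝ) + 2) * onePoint τ N g (n - 1 - 2 * g) ((c : ℕ) : ℤ)) /
          ((n - 1 - 2 * g).factorial : ℝ) else 0) +
      (1 / 2) * (∑ g ∈ Finset.range (n + 1), if 2 * g ≤ n - 2 then
        (∑ b : Fin N, ∑ d : Fin N, twoPoint τ N g (n - 2 - 2 * g) b d) /
          ((n - 2 - 2 * g).factorial : ℝ) else 0) +
      (1 / 2) * ∑ i ∈ Finset.range (n + 1),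
        if 2 ≤ i ∧ 2 ≤ n - i then diagCoeff τ N i * diagCoeff τ N (n - i) else 0 := by
  have shift : (∑ g ∈ Finset.range (n + 1), if 2 * g ≤ n then
        (∑ b : Fin N, ∑ d : Fin N, twoPoint τ N ((g : ℤ) - 1) (n - 2 * g) b d) /
          ((n - 2 * g).factorial : ℝ) else 0) =
      ∑ g ∈ Finset.range (n + 1), if 2 * g ≤ n - 2 then
        (∑ b : Fin N, ∑ d : Fin N, twoPoint τ N g (n - 2 - 2 * g) b d) /
          ((n - 2 - 2 * g).factorial : ℝ) else 0 := by
    rw [Finset.sum_range_succ', Finset.sum_range_succ, if_neg (by omega : ¬2 * n ≤ n - 2)]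
    congr 1
    · refine Finset.sum_congr rfl fun g _ => if_congr (by omega) ?_ rfl
      rw [show n - 2 * (g + 1) = n - 2 - 2 * g by omega]
      push_cast
      rw [add_sub_cancel_right]
    · simp [h.twoPoint_neg_one]
  rw [← sum_antidiagonal_div_factorial, ← shift, Finset.mul_sum, Finset.mul_sum,
    ← Finset.sum_add_distrib, ← Finset.sum_add_distrib, diagCoeff]
  refine Finset.sum_congr rfl fun g _ => ?_
  by_cases hg : 2 * g ≤ n
  · rw [if_pos hg, if_pos hg, if_pos hg, h.onePointSum_recursion (by omega) (by omega)]
    have hB : ((n - 2 * g : ℕ) : ℝ) * (∑ c : Fin N, (((c : ℕ) : ℝ) + 2) *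
          onePoint τ N g (n - 2 * g - 1) ((c : ℕ) : ℤ)) / ((n - 2 * g).factorial : ℝ) =
        if 2 * g ≤ n - 1 then (∑ c : Fin N, (((c : ℕ) : ℝ) + 2) *
          onePoint τ N g (n - 1 - 2 * g) ((c : ℕ) : ℤ)) /
          ((n - 1 - 2 * g).factorial : ℝ) else 0 := by
      split_ifs with hg'
      · obtain ⟨k, hk⟩ : ∃ k, n - 2 * g = k + 1 := ⟨n - 2 * g - 1, by omega⟩
        rw [show n - 1 - 2 * g = k by omega, hk, Nat.add_sub_cancel, Nat.factorial_succ]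
        push_cast
        exact mul_div_mul_left _ _ (by positivity)
      · rw [show n - 2 * g = 0 by omega]
        simp
    rw [← hB]
    ring
  · rw [if_neg hg, if_neg hg, if_neg hg, if_neg (by omega)]
    simp

end Assembly

/-- Equation (5.15) of the paper (`diagSum τ w n = Σ_{2g-1+k=n} (1/(k-1)!) w^{5/2}∂₁Ω_{g,k}`,
summed over stable pairs, with `k = m+1` and `k-1 = m`). -/
theorem Omega_diagonal_recursion (τ : ℤ → (n : ℕ) → (Fin n → ℤ) → ℝ) (h : DVVFamily τ)
    (n : ℕ) (hn : 3 ≤ n) (w : ℝ) (hw : 0 < w) :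
    diagSum τ w n =
      (∑ g ∈ Finset.range (n + 1), if 2 * g ≤ n - 1 then
        (1 / (Nat.factorial (n - 1 - 2 * g) : ℝ)) * Bterm τ w g (n - 1 - 2 * g) else 0)
      + (∑ g ∈ Finset.range (n + 1), if 2 * g ≤ n - 2 then
        (1 / (Nat.factorial (n - 2 - 2 * g) : ℝ)) * Cterm τ w g (n - 2 - 2 * g) else 0)
      + ∑ i ∈ Finset.range (n + 1),
          if 2 ≤ i ∧ 2 ≤ n - i then diagSum τ w i * diagSum τ w (n - i) else 0 := by
  have hn0 : 0 < 3 * n := by omega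
  rw [h.diagSum_eq le_rfl hn0 hw, h.diagCoeff_recursion hn le_rfl, mul_add, mul_add]
  congr 1
  · congr 1
    · rw [Finset.mul_sum]
      refine Finset.sum_congr rfl fun g _ => ?_
      split_ifs with hg
      · rw [h.Bterm_eq (N := 3 * n) (by omega) hn0 hw,
          show 2 * (g : ℝ) + ((n - 1 - 2 * g : ℕ) : ℝ) + 1 = n by
            exact_mod_cast (by omega : 2 * g + (n - 1 - 2 * g) + 1 = n)]
        ring
      · simp
    · rw [Finset.mul_sum, Finset.mul_sum]
      refine Finset.sum_congr rfl fun g _ => ?_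
      split_ifs with hg
      · rw [h.Cterm_eq (N := 3 * n) (by omega) hn0 hw,
          show 2 * (g : ℝ) + ((n - 2 - 2 * g : ℕ) : ℝ) + 2 = n by
            exact_mod_cast (by omega : 2 * g + (n - 2 - 2 * g) + 2 = n)]
        ring
      · simp
  · rw [Finset.mul_sum, Finset.mul_sum]
    refine Finset.sum_congr rfl fun i hi => ?_
    have hi := Finset.mem_range_succ_iff.1 hi
    split_ifs
    · rw [h.diagSum_eq (N := 3 * n) (by omega) hn0 hw,
        h.diagSum_eq (N := 3 * n) (i := n - i) (by omega) hn0 hw,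
        show 3 / 2 * (n : ℝ) = 3 / 2 * (i : ℝ) + 3 / 2 * ((n - i : ℕ) : ℝ) by
          push_cast [hi]
          ring,
        Real.rpow_add hw]
      ring
    · simp
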